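/- arXiv:2111.13038 — 12 statements merged into one kernel-verified Lean document; each statement's English description precedes it below -/
import Mathlib

section
/- Let C and D be two F_{q^m}-linear codes of the same length n. Then Tr(C) ⋆ Tr(D) ⊆ Σ_{i=0}^{m−1} Tr(C ⋆ D^{q^i}), where the sum is the sum of F_q-linear subspaces of F_q^n. -/
open Finset Polynomial

noncomputable section

/-- Componentwise (Schur) product of two linear codes of length `n` over `F`:
the `F`-linear span of `{c ⋆ d : c ∈ C, d ∈ D}`. -/
def schurProd {F : Type*} [Field F] {n : ℕ} (C D : Submodule F (Fin n → F)) :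
    Submodule F (Fin n → F) :=
  Submodule.span F {v | ∃ c ∈ C, ∃ d ∈ D, v = c * d}

/-- Dual code with respect to the standard bilinear form `⟨u,v⟩ = ∑ i, u i * v i`. -/
def dualCode {F : Type*} [Field F] {n : ℕ} (C : Submodule F (Fin n → F)) :
    Submodule F (Fin n → F) where
  carrier := {v | ∀ c ∈ C, ∑ i, v i * c i = 0}
  add_mem' := by
    intro a b ha hb c hc
    simp only [Set.mem_setOf_eq] at *
    simp [Pi.add_apply, add_mul, Finset.sum_add_distrib, ha c hc, hb c hc]
  zero_mem' := by
    intro c hc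
    simp
  smul_mem' := by
    intro t a ha c hc
    simp only [Set.mem_setOf_eq] at *
    simp [Pi.smul_apply, smul_eq_mul, mul_assoc, ← Finset.mul_sum, ha c hc]

/-- Image of a code under the componentwise `t`-th power map (as the span of the
image set, which is a linear code). For `t = q^i` this is `C^{q^i}`. -/
def powCode {F : Type*} [Field F] {n : ℕ} (t : ℕ) (C : Submodule F (Fin n → F)) :
    Submodule F (Fin n → F) :=
  Submodule.span F ((fun c : Fin n → F => fun j => c j ^ t) '' C)

/-- Generalized Reed–Solomon code of dimension `r`, support `x` and multiplier `y`. -/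
def GRSCode {F : Type*} [Field F] {n : ℕ} (r : ℕ) (x y : Fin n → F) :
    Submodule F (Fin n → F) :=
  Submodule.span F
    {v | ∃ P : F[X], P.degree < (r : WithBot ℕ) ∧ v = fun i => y i * P.eval (x i)}

variable (Fq Fqm : Type*) [Field Fq] [Field Fqm] [Algebra Fq Fqm]

/-- The componentwise trace map `F_{q^m}^n → F_q^n`, as an `F_q`-linear map. -/
def trVecLM (n : ℕ) : (Fin n → Fqm) →ₗ[Fq] (Fin n → Fq) :=
  LinearMap.pi fun i => (Algebra.trace Fq Fqm).comp (LinearMap.proj i)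

/-- The trace code `Tr(C)` of an `F_{q^m}`-linear code `C`. -/
def traceCode {n : ℕ} (C : Submodule Fqm (Fin n → Fqm)) : Submodule Fq (Fin n → Fq) :=
  Submodule.map (trVecLM Fq Fqm n) (C.restrictScalars Fq)

/-- The componentwise inclusion `F_q^n → F_{q^m}^n`, as an `F_q`-linear map. -/
def algVecLM (n : ℕ) : (Fin n → Fq) →ₗ[Fq] (Fin n → Fqm) :=
  LinearMap.pi fun i => (Algebra.linearMap Fq Fqm).comp (LinearMap.proj i)

/-- The alternant code `Alt_r(x,y) = GRS_r(x,y)^⊥ ∩ F_q^n`, a code over `F_q`. -/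
def AltCode {n : ℕ} (r : ℕ) (x y : Fin n → Fqm) : Submodule Fq (Fin n → Fq) :=
  Submodule.comap (algVecLM Fq Fqm n) ((dualCode (GRSCode r x y)).restrictScalars Fq)

/-- The codes `B_v`: `B_0 = Alt_{2r-1}(x, y^2)^⊥` and
`B_v = Alt_{r(q^v - q^{v-1} + 1)}(x, y^{q^v+1})^⊥` for `v ≥ 1`. -/
def BCode (q : ℕ) {n : ℕ} (r : ℕ) (x y : Fin n → Fqm) : ℕ → Submodule Fq (Fin n → Fq)
  | 0 => dualCode (AltCode Fq Fqm (2 * r - 1) x fun i => y i ^ 2)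
  | (v + 1) =>
      dualCode (AltCode Fq Fqm (r * (q ^ (v + 1) - q ^ v + 1)) x
        fun i => y i ^ (q ^ (v + 1) + 1))

end

theorem trVecLM_mul_trVecLM {Fq Fqm : Type*} [Field Fq] [Field Fqm] [Algebra Fq Fqm]
    [Fintype Fq] [Finite Fqm] {n : ℕ} (c d : Fin n → Fqm) :
    trVecLM Fq Fqm n c * trVecLM Fq Fqm n d =
      ∑ i ∈ Finset.range (Module.finrank Fq Fqm),
        trVecLM Fq Fqm n (c * fun j => d j ^ Fintype.card Fq ^ i) := by
  rw [← map_sum, ← Finset.mul_sum]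
  funext j
  have h := FiniteField.algebraMap_trace_eq_sum_pow Fq Fqm (d j)
  rw [Nat.card_eq_fintype_card] at h
  simp only [trVecLM, Pi.mul_apply, LinearMap.pi_apply, LinearMap.comp_apply,
    LinearMap.proj_apply, Finset.sum_apply]
  rw [← h, mul_comm (c j), ← Algebra.smul_def, map_smul, smul_eq_mul, mul_comm]

/-- For `F_{q^m}`-linear codes `C, D` of length `n`,
`Tr(C) ⋆ Tr(D) ⊆ ∑_{i=0}^{m-1} Tr(C ⋆ D^{q^i})`. -/
theorem schur_traceCode_le_sum_traceCode_schur_frob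
    (q m n : ℕ) (hm : 0 < m)
    (Fq Fqm : Type*) [Field Fq] [Field Fqm] [Algebra Fq Fqm]
    [Fintype Fq] [Fintype Fqm]
    (hq : Fintype.card Fq = q) (hqm : Fintype.card Fqm = q ^ m)
    (C D : Submodule Fqm (Fin n → Fqm)) :
    schurProd (traceCode Fq Fqm C) (traceCode Fq Fqm D) ≤
      ∑ i ∈ Finset.range m, traceCode Fq Fqm (schurProd C (powCode (q ^ i) D)) := by
  have hfin : Module.finrank Fq Fqm = m := by
    have h := Module.card_eq_pow_finrank (K := Fq) (V := Fqm)
    rw [hqm, hq] at h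
    exact (Nat.pow_right_injective (hq ▸ Fintype.one_lt_card) h).symm
  refine Submodule.span_le.mpr ?_
  rintro _ ⟨_, ⟨c, hc, rfl⟩, _, ⟨d, hd, rfl⟩, rfl⟩
  rw [trVecLM_mul_trVecLM, hfin, hq]
  refine Submodule.sum_mem _ fun i hi => ?_
  have hle : traceCode Fq Fqm (schurProd C (powCode (q ^ i) D)) ≤
      ∑ i ∈ Finset.range m, traceCode Fq Fqm (schurProd C (powCode (q ^ i) D)) :=
    Finset.single_le_sum (f := fun i => traceCode Fq Fqm (schurProd C (powCode (q ^ i) D)))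
      (fun _ _ => bot_le) hi
  exact hle ⟨_, Submodule.subset_span ⟨c, hc, _, Submodule.subset_span ⟨d, hd, rfl⟩, rfl⟩, rfl⟩
end

section
/- Let C and D be two F_{q^m}-linear codes of the same length n such that dim_{F_q} Tr(C) = m·dim_{F_{q^m}} C and dim_{F_q} Tr(D) = m·dim_{F_{q^m}} D. Then dim_{F_q}(Tr(C) ⋆ Tr(D)) − dim_{F_q} Tr(C) · dim_{F_q} Tr(D) ≤ m·(dim_{F_{q^m}}(C ⋆ D) − dim_{F_{q^m}} C · dim_{F_{q^m}} D). -/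
open Finset Polynomial

section TraceProduct

variable (Fq Fqm : Type*) [Field Fq] [Field Fqm] [Algebra Fq Fqm]

/-- The `Fqm`-span of the products `c * σ(d)` with `c ∈ C` and `d ∈ D`, where `σ` acts
componentwise. -/
def twistedProd {n : ℕ} (C D : Submodule Fqm (Fin n → Fqm)) (σ : Gal(Fqm/Fq)) :
    Submodule Fqm (Fin n → Fqm) :=
  Submodule.span Fqm {v | ∃ c ∈ C, ∃ d ∈ D, v = c * fun i => σ (d i)}

theorem twistedProd_one {n : ℕ} (C D : Submodule Fqm (Fin n → Fqm)) :
    twistedProd Fq Fqm C D 1 = schurProd C D := rfl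

theorem finrank_twistedProd_le {n : ℕ} (C D : Submodule Fqm (Fin n → Fqm)) (σ : Gal(Fqm/Fq)) :
    Module.finrank Fqm (twistedProd Fq Fqm C D σ) ≤
      Module.finrank Fqm C * Module.finrank Fqm D := by
  let b := Module.finBasis Fqm C
  let e := Module.finBasis Fqm D
  let f : Fin (Module.finrank Fqm C) × Fin (Module.finrank Fqm D) → Fin n → Fqm :=
    fun p => (b p.1 : Fin n → Fqm) * fun i => σ ((e p.2 : Fin n → Fqm) i)
  have hle : twistedProd Fq Fqm C D σ ≤ Submodule.span Fqm (Set.range f) := by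
    refine Submodule.span_le.2 ?_
    rintro _ ⟨c, hc, d, hd, rfl⟩
    have hc' : c = ∑ j, b.repr ⟨c, hc⟩ j • (b j : Fin n → Fqm) := by
      simpa only [map_sum, map_smul, Submodule.subtype_apply] using
        congrArg C.subtype (b.sum_repr ⟨c, hc⟩).symm
    have hd' : d = ∑ k, e.repr ⟨d, hd⟩ k • (e k : Fin n → Fqm) := by
      simpa only [map_sum, map_smul, Submodule.subtype_apply] using
        congrArg D.subtype (e.sum_repr ⟨d, hd⟩).symm
    have hprod : (c * fun i => σ (d i)) =
        ∑ j, ∑ k, (b.repr ⟨c, hc⟩ j * σ (e.repr ⟨d, hd⟩ k)) • f (j, k) := by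
      funext i
      have hci := congrFun hc' i
      have hdi := congrFun hd' i
      simp only [Finset.sum_apply, Pi.smul_apply, smul_eq_mul] at hci hdi
      rw [Pi.mul_apply, hci, hdi, map_sum, Finset.sum_mul_sum]
      simp only [Finset.sum_apply, Pi.smul_apply, smul_eq_mul, f, Pi.mul_apply, map_mul]
      exact Finset.sum_congr rfl fun j _ => Finset.sum_congr rfl fun k _ => by ring
    rw [hprod]
    exact Submodule.sum_mem _ fun j _ => Submodule.sum_mem _ fun k _ =>
      Submodule.smul_mem _ _ (Submodule.subset_span ⟨_, rfl⟩)
  calc Module.finrank Fqm (twistedProd Fq Fqm C D σ)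
      ≤ Module.finrank Fqm (Submodule.span Fqm (Set.range f)) := Submodule.finrank_mono hle
    _ ≤ _ := (finrank_range_le_card f).trans_eq (by simp)

theorem finrank_traceCode_le [FiniteDimensional Fq Fqm] {n : ℕ}
    (C : Submodule Fqm (Fin n → Fqm)) :
    Module.finrank Fq (traceCode Fq Fqm C) ≤ Module.finrank Fq Fqm * Module.finrank Fqm C := by
  rw [Module.finrank_mul_finrank Fq Fqm C]
  exact Submodule.finrank_map_le (trVecLM Fq Fqm n) (C.restrictScalars Fq)

theorem finrank_finsetSup_le_sum {K V ι : Type*} [Field K] [AddCommGroup V] [Module K V]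
    [FiniteDimensional K V] (s : Finset ι) (W : ι → Submodule K V) :
    Module.finrank K (s.sup W : Submodule K V) ≤ ∑ i ∈ s, Module.finrank K (W i) := by
  classical
  induction s using Finset.induction_on with
  | empty => simp
  | insert a s ha ih =>
    rw [Finset.sup_insert, Finset.sum_insert ha]
    exact (Submodule.finrank_add_le_finrank_add_finrank _ _).trans (by gcongr)

theorem schurProd_traceCode_le [FiniteDimensional Fq Fqm] [IsGalois Fq Fqm] {n : ℕ}
    (C D : Submodule Fqm (Fin n → Fqm)) :
    schurProd (traceCode Fq Fqm C) (traceCode Fq Fqm D) ≤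
      (Finset.univ : Finset Gal(Fqm/Fq)).sup
        fun σ => traceCode Fq Fqm (twistedProd Fq Fqm C D σ) := by
  refine Submodule.span_le.2 ?_
  rintro _ ⟨_, ⟨c, hc, rfl⟩, _, ⟨d, hd, rfl⟩, rfl⟩
  have h : trVecLM Fq Fqm n c * trVecLM Fq Fqm n d =
      ∑ σ : Gal(Fqm/Fq), trVecLM Fq Fqm n (c * fun i => σ (d i)) := by
    rw [← map_sum]
    funext i
    simp only [trVecLM, Pi.mul_apply, LinearMap.pi_apply, LinearMap.comp_apply,
      LinearMap.proj_apply, Finset.sum_apply]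
    rw [← Finset.mul_sum, ← trace_eq_sum_automorphisms, mul_comm (c i), ← Algebra.smul_def,
      map_smul, smul_eq_mul, mul_comm]
  rw [h]
  refine Submodule.sum_mem _ fun σ _ => ?_
  refine Finset.le_sup (f := fun σ => traceCode Fq Fqm (twistedProd Fq Fqm C D σ))
    (Finset.mem_univ σ) ?_
  exact ⟨_, Submodule.subset_span ⟨c, hc, d, hd, rfl⟩, rfl⟩

theorem finrank_schurProd_traceCode_le [FiniteDimensional Fq Fqm] [IsGalois Fq Fqm] {n : ℕ}
    (C D : Submodule Fqm (Fin n → Fqm)) :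
    Module.finrank Fq (schurProd (traceCode Fq Fqm C) (traceCode Fq Fqm D)) ≤
      Module.finrank Fq Fqm * (Module.finrank Fqm (schurProd C D) +
        (Module.finrank Fq Fqm - 1) * (Module.finrank Fqm C * Module.finrank Fqm D)) := by
  classical
  have hcard : (Finset.univ.erase (1 : Gal(Fqm/Fq))).card = Module.finrank Fq Fqm - 1 := by
    rw [Finset.card_erase_of_mem (Finset.mem_univ _), Finset.card_univ,
      ← Nat.card_eq_fintype_card, IsGalois.card_aut_eq_finrank]
  calc Module.finrank Fq (schurProd (traceCode Fq Fqm C) (traceCode Fq Fqm D))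
      ≤ ∑ σ : Gal(Fqm/Fq), Module.finrank Fq (traceCode Fq Fqm (twistedProd Fq Fqm C D σ)) :=
        (Submodule.finrank_mono (schurProd_traceCode_le Fq Fqm C D)).trans
          (finrank_finsetSup_le_sum _ _)
    _ ≤ ∑ σ : Gal(Fqm/Fq),
          Module.finrank Fq Fqm * Module.finrank Fqm (twistedProd Fq Fqm C D σ) :=
        Finset.sum_le_sum fun σ _ => finrank_traceCode_le Fq Fqm _
    _ = Module.finrank Fq Fqm * (Module.finrank Fqm (schurProd C D) +
          ∑ σ ∈ Finset.univ.erase (1 : Gal(Fqm/Fq)),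
            Module.finrank Fqm (twistedProd Fq Fqm C D σ)) := by
        rw [← Finset.mul_sum, ← Finset.add_sum_erase _ _ (Finset.mem_univ (1 : Gal(Fqm/Fq))),
          twistedProd_one]
    _ ≤ _ := by
        gcongr
        rw [← hcard, ← smul_eq_mul]
        exact Finset.sum_le_card_nsmul _ _ _ fun σ _ => finrank_twistedProd_le Fq Fqm C D σ

end TraceProduct

/-- If `dim_{F_q} Tr(C) = m·dim_{F_{q^m}} C` and
`dim_{F_q} Tr(D) = m·dim_{F_{q^m}} D`, then
`dim(Tr(C) ⋆ Tr(D)) − dim Tr(C)·dim Tr(D) ≤ m·(dim(C ⋆ D) − dim C·dim D)`. -/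
theorem finrank_schur_traceCode_sub_le
    (q m n : ℕ) (hm : 0 < m)
    (Fq Fqm : Type*) [Field Fq] [Field Fqm] [Algebra Fq Fqm]
    [Fintype Fq] [Fintype Fqm]
    (hq : Fintype.card Fq = q) (hqm : Fintype.card Fqm = q ^ m)
    (C D : Submodule Fqm (Fin n → Fqm))
    (hC : Module.finrank Fq ↥(traceCode Fq Fqm C) = m * Module.finrank Fqm ↥C)
    (hD : Module.finrank Fq ↥(traceCode Fq Fqm D) = m * Module.finrank Fqm ↥D) :
    (Module.finrank Fq ↥(schurProd (traceCode Fq Fqm C) (traceCode Fq Fqm D)) : ℤ) -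
        (Module.finrank Fq ↥(traceCode Fq Fqm C) : ℤ) *
          (Module.finrank Fq ↥(traceCode Fq Fqm D) : ℤ) ≤
      (m : ℤ) * ((Module.finrank Fqm ↥(schurProd C D) : ℤ) -
        (Module.finrank Fqm ↥C : ℤ) * (Module.finrank Fqm ↥D : ℤ)) := by
  have hfin : Module.finrank Fq Fqm = m := by
    have h := Module.card_eq_pow_finrank (K := Fq) (V := Fqm)
    rw [hqm, hq] at h
    exact (Nat.pow_right_injective (hq ▸ Fintype.one_lt_card : 2 ≤ q) h).symm
  have h := finrank_schurProd_traceCode_le Fq Fqm C D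
  rw [hfin] at h
  zify [hm] at h hC hD
  rw [hC, hD]
  linarith
end

section
/- Let C be an F_{q^m}-linear code of length n. For every non-negative integer u ≤ m, Tr(C ⋆ C^{q^u}) = Tr(C ⋆ C^{q^{m−u}}) as F_q-linear subspaces of F_q^n. -/
open Finset Polynomial

/-- A semilinear form of `Submodule.span_le`, for a ring automorphism `σ` acting componentwise. -/
theorem comp_mem_of_mem_span {F : Type*} [Field F] {n : ℕ} (σ : F ≃+* F)
    {s : Set (Fin n → F)} {B : Submodule F (Fin n → F)}
    (h : ∀ x ∈ s, (fun j => σ (x j)) ∈ B) {x : Fin n → F} (hx : x ∈ Submodule.span F s) :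
    (fun j => σ (x j)) ∈ B := by
  induction hx using Submodule.span_induction with
  | mem x hx => exact h x hx
  | zero => simp only [Pi.zero_apply, map_zero]; exact B.zero_mem
  | add x y _ _ ihx ihy => simp only [Pi.add_apply, map_add]; exact B.add_mem ihx ihy
  | smul a x _ ih =>
    simp only [Pi.smul_apply, smul_eq_mul, map_mul]
    exact B.smul_mem (σ a) ih

/-- If `σ` is the `s`-th power map and `a ^ (t * s) = a` on `F`, then `σ` maps
`C ⋆ C^t` into `C ⋆ C^s`. -/
theorem comp_mem_schurProd_powCode {F : Type*} [Field F] {n : ℕ} (σ : F ≃+* F) {s t : ℕ}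
    (hσ : ∀ a, σ a = a ^ s) (hst : ∀ a : F, a ^ (t * s) = a)
    {C : Submodule F (Fin n → F)} {x : Fin n → F} (hx : x ∈ schurProd C (powCode t C)) :
    (fun j => σ (x j)) ∈ schurProd C (powCode s C) := by
  refine comp_mem_of_mem_span σ ?_ hx
  rintro _ ⟨c, hc, d, hd, rfl⟩
  have hdC : (fun j => σ (d j)) ∈ C := by
    refine comp_mem_of_mem_span σ ?_ hd
    rintro _ ⟨e, he, rfl⟩
    simp only [hσ, ← pow_mul, hst]
    exact he
  refine Submodule.subset_span
    ⟨_, hdC, fun j => c j ^ s, Submodule.subset_span ⟨c, hc, rfl⟩, ?_⟩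
  funext j
  simp only [Pi.mul_apply, hσ, mul_pow, mul_comm]

/-- If `u + v` is a period of the Frobenius of `Fqm` over `Fq`, then
`Tr(C ⋆ C^{q^u}) ≤ Tr(C ⋆ C^{q^v})`. -/
theorem traceCode_schur_frob_le {Fq Fqm : Type*} [Field Fq] [Field Fqm] [Algebra Fq Fqm]
    [Fintype Fq] [Finite Fqm] {n : ℕ} (C : Submodule Fqm (Fin n → Fqm)) {u v : ℕ}
    (huv : ∀ a : Fqm, a ^ Fintype.card Fq ^ (u + v) = a) :
    traceCode Fq Fqm (schurProd C (powCode (Fintype.card Fq ^ u) C)) ≤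
      traceCode Fq Fqm (schurProd C (powCode (Fintype.card Fq ^ v) C)) := by
  rintro _ ⟨x, hx, rfl⟩
  let σ : Fqm ≃ₐ[Fq] Fqm := FiniteField.frobeniusAlgEquivOfAlgebraic Fq Fqm ^ v
  have hσ (a : Fqm) : σ.toRingEquiv a = a ^ Fintype.card Fq ^ v := by
    change (FiniteField.frobeniusAlgEquivOfAlgebraic Fq Fqm ^ v) a = _
    rw [AlgEquiv.coe_pow, FiniteField.coe_frobeniusAlgEquivOfAlgebraic_iterate]
  refine ⟨fun j => σ (x j), comp_mem_schurProd_powCode σ.toRingEquiv hσ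
    (fun a => by rw [← pow_add, huv]) hx, ?_⟩
  funext j
  exact Algebra.trace_eq_of_algEquiv σ (x j)

/-- For an `F_{q^m}`-linear code `C` of length `n` and `0 ≤ u ≤ m`,
`Tr(C ⋆ C^{q^u}) = Tr(C ⋆ C^{q^{m−u}})`. -/
theorem traceCode_schur_frob_symm
    (q m n : ℕ) (hm : 0 < m)
    (Fq Fqm : Type*) [Field Fq] [Field Fqm] [Algebra Fq Fqm]
    [Fintype Fq] [Fintype Fqm]
    (hq : Fintype.card Fq = q) (hqm : Fintype.card Fqm = q ^ m)
    (C : Submodule Fqm (Fin n → Fqm)) (u : ℕ) (hu : u ≤ m) :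
    traceCode Fq Fqm (schurProd C (powCode (q ^ u) C)) =
      traceCode Fq Fqm (schurProd C (powCode (q ^ (m - u)) C)) := by
  subst hq
  have hpow (a : Fqm) : a ^ Fintype.card Fq ^ m = a := by
    rw [← hqm, FiniteField.pow_card]
  apply le_antisymm
  · exact traceCode_schur_frob_le C (by rwa [Nat.add_sub_cancel' hu])
  · exact traceCode_schur_frob_le C (by rwa [Nat.sub_add_cancel hu])
end

section
/- Let C be an F_{q^m}-linear code of length n. Then (Tr(C))^{⋆2} ⊆ Σ_{u=0}^{⌊m/2⌋} Tr(C ⋆ C^{q^u}), where the sum is the sum of F_q-linear subspaces of F_q^n. -/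
open Finset Polynomial

theorem trace_pow_card_pow {K L : Type*} [Field K] [Field L] [Algebra K L]
    [Fintype K] [Finite L] (k : ℕ) (x : L) :
    Algebra.trace K L (x ^ Fintype.card K ^ k) = Algebra.trace K L x := by
  rw [← congrFun (FiniteField.coe_frobeniusAlgEquivOfAlgebraic_iterate K L k) x,
    ← AlgEquiv.coe_pow, Algebra.trace_eq_of_algEquiv]

theorem trace_mul_trace_eq_sum {K L : Type*} [Field K] [Field L] [Algebra K L]
    [Fintype K] [Finite L] (a b : L) :
    Algebra.trace K L a * Algebra.trace K L b =
      ∑ u ∈ Finset.range (Module.finrank K L),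
        Algebra.trace K L (a * b ^ Fintype.card K ^ u) := by
  rw [mul_comm, ← smul_eq_mul, ← map_smul, Algebra.smul_def,
    FiniteField.algebraMap_trace_eq_sum_pow, mul_comm, Finset.mul_sum, map_sum,
    Nat.card_eq_fintype_card]

theorem trace_mul_pow_card_pow {K L : Type*} [Field K] [Field L] [Algebra K L]
    [Fintype K] [Fintype L] {m u : ℕ} (hL : Fintype.card L = Fintype.card K ^ m)
    (hu : u ≤ m) (a b : L) :
    Algebra.trace K L (a * b ^ Fintype.card K ^ u) =
      Algebra.trace K L (b * a ^ Fintype.card K ^ (m - u)) := by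
  rw [← trace_pow_card_pow (m - u), mul_pow, ← pow_mul, ← pow_add,
    Nat.add_sub_cancel' hu, ← hL, FiniteField.pow_card, mul_comm]

theorem trVecLM_mul_pow_mem_traceCode {K L : Type*} [Field K] [Field L] [Algebra K L]
    {n : ℕ} {C : Submodule L (Fin n → L)} {a b : Fin n → L} (ha : a ∈ C) (hb : b ∈ C)
    (t : ℕ) :
    trVecLM K L n (a * b ^ t) ∈ traceCode K L (schurProd C (powCode t C)) :=
  Submodule.mem_map_of_mem (Submodule.subset_span
    ⟨a, ha, b ^ t, Submodule.subset_span ⟨b, hb, rfl⟩, rfl⟩)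

/-- For an `F_{q^m}`-linear code `C` of length `n`,
`(Tr(C))^{⋆2} ⊆ ∑_{u=0}^{⌊m/2⌋} Tr(C ⋆ C^{q^u})`. -/
theorem sq_traceCode_le_sum_traceCode_schur_frob
    (q m n : ℕ) (hm : 0 < m)
    (Fq Fqm : Type*) [Field Fq] [Field Fqm] [Algebra Fq Fqm]
    [Fintype Fq] [Fintype Fqm]
    (hq : Fintype.card Fq = q) (hqm : Fintype.card Fqm = q ^ m)
    (C : Submodule Fqm (Fin n → Fqm)) :
    schurProd (traceCode Fq Fqm C) (traceCode Fq Fqm C) ≤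
      ∑ u ∈ Finset.range (m / 2 + 1),
        traceCode Fq Fqm (schurProd C (powCode (q ^ u) C)) := by
  subst hq
  have hrank : Module.finrank Fq Fqm = m :=
    Nat.pow_right_injective (Fintype.one_lt_card (α := Fq))
      ((Module.card_eq_pow_finrank (K := Fq) (V := Fqm)).symm.trans hqm)
  have hle (u : ℕ) (hu : u ≤ m / 2) :
      traceCode Fq Fqm (schurProd C (powCode (Fintype.card Fq ^ u) C)) ≤
        ∑ u ∈ Finset.range (m / 2 + 1),
          traceCode Fq Fqm (schurProd C (powCode (Fintype.card Fq ^ u) C)) :=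
    Finset.single_le_sum_of_canonicallyOrdered
      (f := fun u => traceCode Fq Fqm (schurProd C (powCode (Fintype.card Fq ^ u) C)))
      (Finset.mem_range.2 (Nat.lt_succ_of_le hu))
  refine Submodule.span_le.2 ?_
  rintro _ ⟨_, ⟨a, ha, rfl⟩, _, ⟨b, hb, rfl⟩, rfl⟩
  have hsum : trVecLM Fq Fqm n a * trVecLM Fq Fqm n b =
      ∑ u ∈ Finset.range m, trVecLM Fq Fqm n (a * b ^ Fintype.card Fq ^ u) := by
    ext i
    simpa [trVecLM, hrank] using trace_mul_trace_eq_sum (K := Fq) (a i) (b i)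
  rw [hsum]
  refine Submodule.sum_mem _ fun u hu => ?_
  have hum : u < m := Finset.mem_range.1 hu
  by_cases hu2 : u ≤ m / 2
  · exact hle u hu2 (trVecLM_mul_pow_mem_traceCode ha hb _)
  · have hswap : trVecLM Fq Fqm n (a * b ^ Fintype.card Fq ^ u) =
        trVecLM Fq Fqm n (b * a ^ Fintype.card Fq ^ (m - u)) := by
      ext i
      exact trace_mul_pow_card_pow hqm hum.le (a i) (b i)
    rw [hswap]
    exact hle (m - u) (by omega) (trVecLM_mul_pow_mem_traceCode hb ha _)
end

section
/- Let C be an F_{q^m}-linear code of length n and suppose m is even. Then dim_{F_q} Tr(C ⋆ C^{q^{m/2}}) ≤ m·(dim_{F_{q^m}} C)^2 / 2. -/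
open Finset Polynomial

section

open Module

variable (F L : Type*) [Field F] [Field L] [Algebra F L] {ι : Type*}

/-- The conjugate transpose, twisted by `σ`, of a square array of scalars. -/
def twistedTranspose (σ : L →ₐ[F] L) : (ι × ι → L) →ₗ[F] (ι × ι → L) :=
  LinearMap.pi fun p => σ.toLinearMap.comp (LinearMap.proj p.swap)

variable {F L}

@[simp]
theorem twistedTranspose_apply (σ : L →ₐ[F] L) (A : ι × ι → L) (p : ι × ι) :
    twistedTranspose F L σ A p = σ (A p.swap) := rfl

/-- Hermitian arrays form at most half of the space of all square arrays. -/
theorem two_mul_finrank_ker_sub_twistedTranspose_le [Finite ι] [FiniteDimensional F L]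
    {σ : L →ₐ[F] L} (hσ : σ ≠ 1) :
    2 * finrank F (LinearMap.ker
        (LinearMap.id - twistedTranspose F L σ : (ι × ι → L) →ₗ[F] (ι × ι → L))) ≤
      finrank F (ι × ι → L) := by
  set H := LinearMap.ker
    (LinearMap.id - twistedTranspose F L σ : (ι × ι → L) →ₗ[F] (ι × ι → L))
  obtain ⟨a, ha⟩ : ∃ a, σ a ≠ a := by
    by_contra! h
    exact hσ (AlgHom.ext h)
  have ha0 : a ≠ 0 := by
    rintro rfl
    exact ha (map_zero σ)
  have hmem : ∀ A ∈ H, ∀ p, A p = σ (A p.swap) := fun A hA p =>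
    sub_eq_zero.1 (congrFun (LinearMap.mem_ker.1 hA) p)
  let M : (ι × ι → L) →ₗ[F] (ι × ι → L) := LinearMap.mulLeft F (fun _ => a)
  have hM : Function.Injective M := fun A B h => by
    funext p
    exact mul_left_cancel₀ ha0 (congrFun h p)
  have hdisj : Disjoint H (H.map M) := by
    rw [Submodule.disjoint_def]
    rintro _ hA ⟨B, hB, rfl⟩
    have hB0 : B = 0 := by
      funext p
      have h1 : a * B p = σ (a * B p.swap) := hmem _ hA p
      rw [map_mul, ← hmem B hB p] at h1
      by_contra hne
      exact ha (mul_right_cancel₀ hne h1).symm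
    rw [hB0, map_zero]
  have h := Submodule.finrank_add_finrank_le_of_disjoint hdisj
  rw [← (Submodule.equivMapOfInjective M hM H).finrank_eq] at h
  omega

/-- A linear map invariant under the twisted transpose has rank at most half the dimension. -/
theorem two_mul_finrank_range_le_of_comp_twistedTranspose [Finite ι] [FiniteDimensional F L]
    {W : Type*} [AddCommGroup W] [Module F W] {σ : L →ₐ[F] L} (hσ : σ ≠ 1)
    (T : (ι × ι → L) →ₗ[F] W) (hT : ∀ A, T (twistedTranspose F L σ A) = T A) :
    2 * finrank F (LinearMap.range T) ≤ finrank F (ι × ι → L) := by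
  have hle : LinearMap.range (LinearMap.id - twistedTranspose F L σ) ≤ LinearMap.ker T := by
    rintro _ ⟨A, rfl⟩
    simp [hT]
  have h1 := Submodule.finrank_mono hle
  have h2 := LinearMap.finrank_range_add_finrank_ker T
  have h3 := LinearMap.finrank_range_add_finrank_ker
    (LinearMap.id - twistedTranspose F L σ : (ι × ι → L) →ₗ[F] (ι × ι → L))
  have h4 := two_mul_finrank_ker_sub_twistedTranspose_le (ι := ι) hσ
  omega

/-- The linear combinations of the products `b i ⋆ σ (b j)`. -/
def sesquilinearCombination [Fintype ι] {n : ℕ} (σ : L →ₐ[F] L) (b : ι → Fin n → L) :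
    (ι × ι → L) →ₗ[L] (Fin n → L) :=
  Fintype.linearCombination L fun p => b p.1 * fun i => σ (b p.2 i)

theorem sesquilinearCombination_apply [Fintype ι] {n : ℕ} (σ : L →ₐ[F] L) (b : ι → Fin n → L)
    (A : ι × ι → L) (i : Fin n) :
    sesquilinearCombination σ b A i = ∑ p, A p * (b p.1 i * σ (b p.2 i)) := by
  simp [sesquilinearCombination, Fintype.linearCombination_apply]

theorem sesquilinearCombination_twistedTranspose [Fintype ι] {n : ℕ} {σ : L →ₐ[F] L}
    (hσ : ∀ x, σ (σ x) = x) (b : ι → Fin n → L) (A : ι × ι → L) (i : Fin n) :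
    sesquilinearCombination σ b (twistedTranspose F L σ A) i =
      σ (sesquilinearCombination σ b A i) := by
  simp only [sesquilinearCombination_apply, map_sum, map_mul, hσ, twistedTranspose_apply]
  refine Fintype.sum_equiv (Equiv.prodComm ι ι) _ _ fun p => ?_
  simp [mul_comm]

theorem schurProd_powCode_le_range [Fintype ι] {n t : ℕ} {σ : L →ₐ[F] L}
    (hσ : ∀ x, σ x = x ^ t) {C : Submodule L (Fin n → L)} (b : Basis ι L C) :
    schurProd C (powCode t C) ≤
      LinearMap.range (sesquilinearCombination σ fun i => (b i : Fin n → L)) := by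
  refine Submodule.span_le.2 ?_
  rintro _ ⟨c, hc, d, hd, rfl⟩
  rw [SetLike.mem_coe]
  have hexp : ∀ e (he : e ∈ C) (j : Fin n),
      e j = ∑ i, b.repr ⟨e, he⟩ i * (b i : Fin n → L) j := fun e he j => by
    have h := congrFun (congrArg C.subtype (b.sum_repr ⟨e, he⟩)) j
    rw [map_sum, Finset.sum_apply] at h
    exact h.symm
  induction hd using Submodule.span_induction with
  | mem _ h =>
    obtain ⟨e, he, rfl⟩ := h
    refine ⟨fun p => b.repr ⟨c, hc⟩ p.1 * σ (b.repr ⟨e, he⟩ p.2), ?_⟩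
    funext j
    rw [sesquilinearCombination_apply, Pi.mul_apply]
    beta_reduce
    rw [← hσ, hexp c hc j, hexp e he j, map_sum,
      Finset.sum_mul_sum, Fintype.sum_prod_type]
    refine Finset.sum_congr rfl fun _ _ => Finset.sum_congr rfl fun _ _ => ?_
    rw [map_mul]
    ring
  | zero => simp
  | add x y _ _ hx hy =>
    rw [mul_add]
    exact add_mem hx hy
  | smul a x _ hx =>
    rw [mul_smul_comm]
    exact Submodule.smul_mem _ a hx

/-- Dimension bound for the trace code of `C ⋆ σ(C)`, where the nontrivial involution `σ` acts as a
power map. -/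
theorem two_mul_finrank_traceCode_schurProd_powCode_le [FiniteDimensional F L] {n t : ℕ}
    {σ : L →ₐ[F] L} (hσ1 : σ ≠ 1) (hσ2 : ∀ x, σ (σ x) = x) (hσ : ∀ x, σ x = x ^ t)
    (C : Submodule L (Fin n → L)) :
    2 * finrank F (traceCode F L (schurProd C (powCode t C))) ≤
      finrank F L * finrank L C ^ 2 := by
  let b := finBasis L C
  let S := sesquilinearCombination σ fun i => (b i : Fin n → L)
  let T := (trVecLM F L n).comp (S.restrictScalars F)
  have hT : ∀ A, T (twistedTranspose F L σ A) = T A := fun A => by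
    funext i
    change Algebra.trace F L (S _ i) = Algebra.trace F L (S A i)
    rw [sesquilinearCombination_twistedTranspose hσ2]
    exact Algebra.trace_eq_of_algEquiv
      (AlgEquiv.ofAlgHom σ σ (AlgHom.ext hσ2) (AlgHom.ext hσ2)) _
  have hle : traceCode F L (schurProd C (powCode t C)) ≤ LinearMap.range T := by
    rintro _ ⟨v, hv, rfl⟩
    obtain ⟨A, rfl⟩ := schurProd_powCode_le_range hσ b hv
    exact ⟨A, rfl⟩
  calc 2 * finrank F (traceCode F L (schurProd C (powCode t C)))
      ≤ 2 * finrank F (LinearMap.range T) := Nat.mul_le_mul_left 2 (Submodule.finrank_mono hle)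
    _ ≤ finrank F (Fin (finrank L C) × Fin (finrank L C) → L) :=
        two_mul_finrank_range_le_of_comp_twistedTranspose hσ1 T hT
    _ = finrank F L * finrank L C ^ 2 := by
        rw [finrank_pi_fintype]
        simp
        ring

end

/-- For an `F_{q^m}`-linear code `C` of length `n` with `m` even,
`dim_{F_q} Tr(C ⋆ C^{q^{m/2}}) ≤ m·(dim_{F_{q^m}} C)² / 2`. -/
theorem finrank_traceCode_schur_frob_half_le
    (q m n : ℕ) (hm : 0 < m) (hmeven : Even m)
    (Fq Fqm : Type*) [Field Fq] [Field Fqm] [Algebra Fq Fqm]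
    [Fintype Fq] [Fintype Fqm]
    (hq : Fintype.card Fq = q) (hqm : Fintype.card Fqm = q ^ m)
    (C : Submodule Fqm (Fin n → Fqm)) :
    (Module.finrank Fq ↥(traceCode Fq Fqm (schurProd C (powCode (q ^ (m / 2)) C))) : ℚ) ≤
      (m : ℚ) * (Module.finrank Fqm ↥C : ℚ) ^ 2 / 2 := by
  have hfd : FiniteDimensional Fq Fqm := Module.Finite.of_finite
  have hq1 : 1 < q := hq ▸ Fintype.one_lt_card
  have hrank : Module.finrank Fq Fqm = m := by
    have h := Module.card_eq_pow_finrank (K := Fq) (V := Fqm)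
    rw [hq, hqm] at h
    exact (Nat.pow_right_injective hq1 h).symm
  have horder : orderOf (FiniteField.frobeniusAlgHom Fq Fqm) = m :=
    (FiniteField.orderOf_frobeniusAlgHom Fq Fqm).trans hrank
  have happly : ∀ x, (FiniteField.frobeniusAlgHom Fq Fqm ^ (m / 2)) x = x ^ q ^ (m / 2) := by
    intro x
    rw [AlgHom.coe_pow, FiniteField.coe_frobeniusAlgHom, pow_iterate, hq]
  have hne : FiniteField.frobeniusAlgHom Fq Fqm ^ (m / 2) ≠ 1 :=
    pow_ne_one_of_lt_orderOf (by grind) (by omega)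
  have hinv : ∀ x, (FiniteField.frobeniusAlgHom Fq Fqm ^ (m / 2))
      ((FiniteField.frobeniusAlgHom Fq Fqm ^ (m / 2)) x) = x := by
    intro x
    rw [happly, happly, ← pow_mul, ← pow_add, ← two_mul, Nat.two_mul_div_two_of_even hmeven,
      ← hqm, FiniteField.pow_card]
  have h := two_mul_finrank_traceCode_schurProd_powCode_le hne hinv happly C
  rw [hrank] at h
  rw [le_div_iff₀ two_pos, mul_comm]
  exact_mod_cast h
end

section
/- Let C be an F_{q^m}-linear code of length n. Then dim_{F_q}(Tr(C))^{⋆2} ≤ m·dim_{F_{q^m}}(C^{⋆2}) + binom(m,2)·(dim_{F_{q^m}} C)^2. -/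
open Finset Polynomial

/-- Vectors independent over a field remain independent after extension of scalars. -/
theorem LinearIndependent.algVecLM {F K : Type*} [Field F] [Field K] [Algebra F K] {n : ℕ}
    {ι : Type*} [Fintype ι] {v : ι → Fin n → F} (hv : LinearIndependent F v) :
    LinearIndependent K fun i => algVecLM F K n (v i) := by
  rw [Fintype.linearIndependent_iff] at hv ⊢
  intro g hg i
  rw [← Module.forall_dual_apply_eq_zero_iff F]
  intro φ
  refine hv (fun i => φ (g i)) ?_ i
  funext x
  have h := congrArg φ (congrFun hg x)
  simp only [Finset.sum_apply, Pi.smul_apply, smul_eq_mul, Pi.zero_apply, map_zero, map_sum,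
    _root_.algVecLM, LinearMap.pi_apply, LinearMap.comp_apply, LinearMap.proj_apply,
    Algebra.linearMap_apply] at h ⊢
  rw [← h]
  refine Finset.sum_congr rfl fun j _ => ?_
  rw [mul_comm (g j), ← Algebra.smul_def, map_smul, smul_eq_mul, mul_comm]

/-- The dimension of a code is at most that of any code over an extension field containing it. -/
theorem finrank_le_of_algVecLM_mem {F K : Type*} [Field F] [Field K] [Algebra F K] {n : ℕ}
    {S : Submodule F (Fin n → F)} {W : Submodule K (Fin n → K)}
    (h : ∀ s ∈ S, algVecLM F K n s ∈ W) :
    Module.finrank F S ≤ Module.finrank K W := by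
  have hli := (((Module.finBasis F S).linearIndependent.map' S.subtype
    S.ker_subtype).algVecLM (K := K))
  have hcard := finrank_span_eq_card hli
  rw [Fintype.card_fin] at hcard
  rw [← hcard]
  refine Submodule.finrank_mono (Submodule.span_le.mpr ?_)
  rintro _ ⟨i, rfl⟩
  exact h _ (Module.finBasis F S i).2

/-- Componentwise application of a field automorphism to a member of a code. -/
theorem comp_eq_sum_repr {K ι G : Type*} [Field K] [FunLike G K K] [RingHomClass G K K]
    [Fintype ι] {n : ℕ} {C : Submodule K (Fin n → K)} (b : Module.Basis ι K C) (σ : G) (c : C) :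
    (fun x => σ (c.1 x)) = ∑ i, σ (b.repr c i) • fun x => σ ((b i).1 x) := by
  funext x
  have h : c.1 = ∑ i, b.repr c i • (b i).1 := by
    have h := congrArg C.subtype (b.sum_repr c)
    rw [map_sum] at h
    exact h.symm
  rw [h]
  simp

/-- For an `F_{q^m}`-linear code `C` of length `n`,
`dim_{F_q} (Tr(C))^{⋆2} ≤ m·dim_{F_{q^m}}(C^{⋆2}) + binom(m,2)·(dim_{F_{q^m}} C)²`. -/
theorem finrank_sq_traceCode_le
    (q m n : ℕ) (hm : 0 < m)
    (Fq Fqm : Type*) [Field Fq] [Field Fqm] [Algebra Fq Fqm]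
    [Fintype Fq] [Fintype Fqm]
    (hq : Fintype.card Fq = q) (hqm : Fintype.card Fqm = q ^ m)
    (C : Submodule Fqm (Fin n → Fqm)) :
    Module.finrank Fq ↥(schurProd (traceCode Fq Fqm C) (traceCode Fq Fqm C)) ≤
      m * Module.finrank Fqm ↥(schurProd C C) +
        Nat.choose m 2 * (Module.finrank Fqm ↥C) ^ 2 := by
  classical
  have hG : Fintype.card (Fqm ≃ₐ[Fq] Fqm) = m := by
    rw [← Nat.card_eq_fintype_card, IsGalois.card_aut_eq_finrank]
    have h := Module.card_eq_pow_finrank (K := Fq) (V := Fqm)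
    rw [hqm, hq] at h
    exact (Nat.pow_right_injective (hq ▸ Fintype.one_lt_card) h).symm
  let e : Fin m ≃ (Fqm ≃ₐ[Fq] Fqm) := (Fintype.equivFinOfCardEq hG).symm
  let b := Module.finBasis Fqm C
  let d := Module.finBasis Fqm (schurProd C C)
  let v : (Fin m × Fin (Module.finrank Fqm (schurProd C C))) ⊕
      ((Σ j : Fin m, Fin j) × (Fin (Module.finrank Fqm C) × Fin (Module.finrank Fqm C))) →
      Fin n → Fqm := Sum.elim (fun p x => e p.1 ((d p.2).1 x))
    (fun p => (fun x => e (Fin.castLE p.1.1.2.le p.1.2) ((b p.2.1).1 x)) *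
      fun x => e p.1.1 ((b p.2.2).1 x))
  let W := Submodule.span Fqm (Set.range v)
  have hW : Module.finrank Fqm W ≤ m * Module.finrank Fqm (schurProd C C) +
      Nat.choose m 2 * Module.finrank Fqm C ^ 2 := by
    refine (finrank_range_le_card v).trans_eq ?_
    simp [Fin.sum_univ_eq_sum_range (fun i => i) m, Finset.sum_range_id, Nat.choose_two_right, sq]
  refine le_trans (finrank_le_of_algVecLM_mem (W := W) ?_) hW
  have hdiag (i : Fin m) (y : schurProd C C) : (fun x => e i (y.1 x)) ∈ W := by
    rw [comp_eq_sum_repr d]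
    exact Submodule.sum_mem _ fun l _ => Submodule.smul_mem _ _
      (Submodule.subset_span ⟨Sum.inl (i, l), rfl⟩)
  have hlt (i j : Fin m) (hij : i < j) (y z : C) :
      ((fun x => e i (y.1 x)) * fun x => e j (z.1 x)) ∈ W := by
    rw [comp_eq_sum_repr b, comp_eq_sum_repr b, Finset.sum_mul_sum]
    refine Submodule.sum_mem _ fun k _ => Submodule.sum_mem _ fun l _ => ?_
    rw [smul_mul_smul_comm]
    exact Submodule.smul_mem _ _
      (Submodule.subset_span ⟨Sum.inr (⟨j, ⟨i, hij⟩⟩, (k, l)), rfl⟩)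
  have hpair (i j : Fin m) (y z : C) :
      ((fun x => e i (y.1 x)) * fun x => e j (z.1 x)) ∈ W := by
    rcases lt_trichotomy i j with hij | rfl | hij
    · exact hlt i j hij y z
    · have h := hdiag i ⟨y.1 * z.1, Submodule.subset_span ⟨y.1, y.2, z.1, z.2, rfl⟩⟩
      convert h using 1
      funext x
      exact (map_mul (e i) (y.1 x) (z.1 x)).symm
    · rw [mul_comm]
      exact hlt j i hij z y
  suffices schurProd (traceCode Fq Fqm C) (traceCode Fq Fqm C) ≤
      (W.restrictScalars Fq).comap (algVecLM Fq Fqm n) from fun s hs => this hs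
  refine Submodule.span_le.mpr ?_
  rintro _ ⟨_, ⟨y, hy, rfl⟩, _, ⟨z, hz, rfl⟩, rfl⟩
  have hsum : algVecLM Fq Fqm n (trVecLM Fq Fqm n y * trVecLM Fq Fqm n z) =
      ∑ i, ∑ j, (fun x => e i (y x)) * fun x => e j (z x) := by
    funext x
    simp only [algVecLM, trVecLM, LinearMap.pi_apply, LinearMap.comp_apply, LinearMap.proj_apply,
      Algebra.linearMap_apply, Pi.mul_apply, map_mul, trace_eq_sum_automorphisms,
      Finset.sum_apply]
    rw [← e.sum_comp, ← e.sum_comp, Finset.sum_mul_sum]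
  change algVecLM Fq Fqm n _ ∈ W
  rw [hsum]
  exact Submodule.sum_mem _ fun i _ => Submodule.sum_mem _ fun j _ =>
    hpair i j ⟨y, hy⟩ ⟨z, hz⟩
end

section
/- Let C be an F_{q^m}-linear code of length n such that dim_{F_q} Tr(C) = m·dim_{F_{q^m}} C. Then dim_{F_q}(Tr(C))^{⋆2} − binom(dim_{F_q} Tr(C) + 1, 2) ≤ m·(dim_{F_{q^m}}(C^{⋆2}) − binom(dim_{F_{q^m}} C + 1, 2)). -/
open Finset Polynomial

/-- Extension of scalars does not decrease dimension: a code over `K` whose image over `L` lies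
in an `L`-linear code `S` has dimension at most that of `S`. -/
theorem finrank_le_of_algebraMap_comp_mem {K L : Type*} [Field K] [Field L] [Algebra K L]
    {n : ℕ} {D : Submodule K (Fin n → K)} {S : Submodule L (Fin n → L)}
    (h : ∀ v ∈ D, (fun i => algebraMap K L (v i)) ∈ S) :
    Module.finrank K D ≤ Module.finrank L S := by
  let b := Module.finBasis K D
  have hb : LinearIndependent K (fun i => (b i : Fin n → K)) :=
    b.linearIndependent.map' D.subtype D.ker_subtype
  have hbL := (linearIndependent_algebraMap_comp_iff (S := L)).2 hb
  have hS : LinearIndependent L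
      (fun i => (⟨fun j => algebraMap K L ((b i : Fin n → K) j), h _ (b i).2⟩ : S)) :=
    LinearIndependent.of_comp S.subtype hbL
  simpa using hS.fintype_card_le_finrank

/-- A ring endomorphism applied componentwise to the span of `e` lands in the span of its
componentwise images of `e`. -/
theorem comp_mem_span_range_of_mem_span_range {L ι : Type*} [Field L] [Finite ι] {n : ℕ}
    (σ : L →+* L) (e : ι → Fin n → L) {a : Fin n → L}
    (ha : a ∈ Submodule.span L (Set.range e)) :
    (fun x => σ (a x)) ∈ Submodule.span L (Set.range fun l x => σ (e l x)) := by
  have := Fintype.ofFinite ι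
  obtain ⟨c, rfl⟩ := (Submodule.mem_span_range_iff_exists_fun L).1 ha
  refine (Submodule.mem_span_range_iff_exists_fun L).2 ⟨fun l => σ (c l), ?_⟩
  ext x
  simp [Finset.sum_apply]

/-- The product of elements of two spans lies in the span of the products of generators. -/
theorem mul_mem_span_range {L ι κ : Type*} [Field L] {n : ℕ}
    {u : ι → Fin n → L} {w : κ → Fin n → L} {a b : Fin n → L}
    (ha : a ∈ Submodule.span L (Set.range u)) (hb : b ∈ Submodule.span L (Set.range w)) :
    a * b ∈ Submodule.span L (Set.range fun p : ι × κ => u p.1 * w p.2) := by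
  have h := Submodule.mul_mem_mul ha hb
  rw [Submodule.span_mul_span] at h
  refine Submodule.span_mono ?_ h
  rintro _ ⟨_, ⟨i, rfl⟩, _, ⟨j, rfl⟩, rfl⟩
  exact ⟨(i, j), rfl⟩

theorem span_range_coe_finBasis {L V : Type*} [Field L] [AddCommGroup V] [Module L V]
    [Module.Finite L V] (C : Submodule L V) :
    Submodule.span L (Set.range fun l => (Module.finBasis L C l : V)) = C := by
  have h := congrArg (Submodule.map C.subtype) (Module.finBasis L C).span_eq
  rwa [Submodule.map_span, ← Set.range_comp, Submodule.map_top, Submodule.range_subtype] at h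

theorem card_sigma_fin_val (m : ℕ) : Fintype.card (Σ j : Fin m, Fin j) = m.choose 2 := by
  simp [Fin.sum_univ_eq_sum_range (fun i => i), Finset.sum_range_id, Nat.choose_two_right]

/-- If the trace of `L/K` is the sum of `m` ring endomorphisms of `L`, then
`dim (Tr C)^{⋆2} ≤ m · dim C^{⋆2} + binom(m, 2) · (dim C)^2`. -/
theorem finrank_schurProd_traceCode_le_s7 {K L : Type*} [Field K] [Field L] [Algebra K L]
    {n m : ℕ} (σ : Fin m → L →+* L)
    (hσ : ∀ x, algebraMap K L (Algebra.trace K L x) = ∑ i, σ i x)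
    (C : Submodule L (Fin n → L)) :
    Module.finrank K (schurProd (traceCode K L C) (traceCode K L C)) ≤
      m * Module.finrank L (schurProd C C) + m.choose 2 * Module.finrank L C ^ 2 := by
  let e := fun l => (Module.finBasis L (schurProd C C) l : Fin n → L)
  let c := fun l => (Module.finBasis L C l : Fin n → L)
  have he : Submodule.span L (Set.range e) = schurProd C C := span_range_coe_finBasis _
  have hc : Submodule.span L (Set.range c) = C := span_range_coe_finBasis _
  let v : (Fin m × Fin (Module.finrank L (schurProd C C))) ⊕
      ((Σ j : Fin m, Fin j) × Fin (Module.finrank L C) × Fin (Module.finrank L C)) →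
      Fin n → L :=
    Sum.elim (fun p x => σ p.1 (e p.2 x))
      (fun p => (fun x => σ p.1.1 (c p.2.1 x)) *
        fun x => σ (Fin.castLE p.1.1.2.le p.1.2) (c p.2.2 x))
  have hlt : ∀ i j : Fin m, j < i → ∀ a ∈ C, ∀ b ∈ C,
      (fun x => σ i (a x)) * (fun x => σ j (b x)) ∈ Submodule.span L (Set.range v) := by
    intro i j hij a ha b hb
    have h := mul_mem_span_range
      (comp_mem_span_range_of_mem_span_range (σ i) c (hc.symm ▸ ha))
      (comp_mem_span_range_of_mem_span_range (σ j) c (hc.symm ▸ hb))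
    refine Submodule.span_mono ?_ h
    rintro _ ⟨p, rfl⟩
    exact ⟨Sum.inr (⟨i, ⟨j, hij⟩⟩, p), rfl⟩
  have hmul : ∀ i j : Fin m, ∀ a ∈ C, ∀ b ∈ C,
      (fun x => σ i (a x)) * (fun x => σ j (b x)) ∈ Submodule.span L (Set.range v) := by
    intro i j a ha b hb
    rcases lt_trichotomy i j with hij | rfl | hij
    · rw [mul_comm]
      exact hlt j i hij b hb a ha
    · have hab : a * b ∈ Submodule.span L (Set.range e) :=
        he.symm ▸ Submodule.subset_span ⟨a, ha, b, hb, rfl⟩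
      have h := comp_mem_span_range_of_mem_span_range (σ i) e hab
      have hv : (fun x => σ i (a x)) * (fun x => σ i (b x)) = fun x => σ i ((a * b) x) := by
        ext x
        simp
      rw [hv]
      refine Submodule.span_mono ?_ h
      rintro _ ⟨l, rfl⟩
      exact ⟨Sum.inl (i, l), rfl⟩
    · exact hlt i j hij a ha b hb
  have hD : ∀ w ∈ schurProd (traceCode K L C) (traceCode K L C),
      (fun x => algebraMap K L (w x)) ∈ Submodule.span L (Set.range v) := by
    intro w hw
    have hle : schurProd (traceCode K L C) (traceCode K L C) ≤
        ((Submodule.span L (Set.range v)).restrictScalars K).comap (algVecLM K L n) := by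
      refine Submodule.span_le.2 ?_
      rintro _ ⟨_, ⟨a, ha, rfl⟩, _, ⟨b, hb, rfl⟩, rfl⟩
      have hsum : algVecLM K L n (trVecLM K L n a * trVecLM K L n b) =
          ∑ i, ∑ j, (fun x => σ i (a x)) * (fun x => σ j (b x)) := by
        ext x
        simp [algVecLM, trVecLM, hσ, Finset.sum_apply, Finset.sum_mul_sum]
      change algVecLM K L n (trVecLM K L n a * trVecLM K L n b) ∈ Submodule.span L (Set.range v)
      rw [hsum]
      exact Submodule.sum_mem _ fun i _ => Submodule.sum_mem _ fun j _ => hmul i j a ha b hb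
    exact hle hw
  refine (finrank_le_of_algebraMap_comp_mem hD).trans ((finrank_range_le_card v).trans_eq ?_)
  rw [Fintype.card_sum, Fintype.card_prod, Fintype.card_prod, Fintype.card_prod,
    card_sigma_fin_val]
  simp only [Fintype.card_fin]
  ring

theorem choose_two_mul_succ (m k : ℕ) :
    (m * k + 1).choose 2 = m * (k + 1).choose 2 + m.choose 2 * k ^ 2 := by
  apply Nat.cast_injective (R := ℚ)
  push_cast [Nat.cast_choose_two]
  ring

/-- If `dim_{F_q} Tr(C) = m·dim_{F_{q^m}} C`, then
`dim (Tr(C))^{⋆2} − binom(dim Tr(C)+1, 2) ≤ m·(dim C^{⋆2} − binom(dim C + 1, 2))`. -/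
theorem finrank_sq_traceCode_sub_choose_le
    (q m n : ℕ) (hm : 0 < m)
    (Fq Fqm : Type*) [Field Fq] [Field Fqm] [Algebra Fq Fqm]
    [Fintype Fq] [Fintype Fqm]
    (hq : Fintype.card Fq = q) (hqm : Fintype.card Fqm = q ^ m)
    (C : Submodule Fqm (Fin n → Fqm))
    (hC : Module.finrank Fq ↥(traceCode Fq Fqm C) = m * Module.finrank Fqm ↥C) :
    (Module.finrank Fq ↥(schurProd (traceCode Fq Fqm C) (traceCode Fq Fqm C)) : ℤ) -
        (Nat.choose (Module.finrank Fq ↥(traceCode Fq Fqm C) + 1) 2 : ℤ) ≤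
      (m : ℤ) * ((Module.finrank Fqm ↥(schurProd C C) : ℤ) -
        (Nat.choose (Module.finrank Fqm ↥C + 1) 2 : ℤ)) := by
  have hfin : Module.finrank Fq Fqm = m := by
    have h := Module.card_eq_pow_finrank (K := Fq) (V := Fqm)
    rw [hqm, hq] at h
    exact (Nat.pow_right_injective (hq ▸ Fintype.one_lt_card) h).symm
  have hσ : ∀ x : Fqm, algebraMap Fq Fqm (Algebra.trace Fq Fqm x) =
      ∑ i : Fin m, ((FiniteField.frobeniusAlgHom Fq Fqm ^ (i : ℕ) : Fqm →ₐ[Fq] Fqm) :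
        Fqm →+* Fqm) x := by
    intro x
    rw [FiniteField.algebraMap_trace_eq_sum_pow, hfin, Finset.sum_range]
    refine Finset.sum_congr rfl fun i _ => ?_
    simp [AlgHom.coe_pow, FiniteField.coe_frobeniusAlgHom, pow_iterate]
  have h := finrank_schurProd_traceCode_le_s7 _ hσ C
  rw [hC, choose_two_mul_succ]
  zify at h
  push_cast
  linarith
end

section
/- Let x ∈ F_{q^m}^n have pairwise distinct entries, y ∈ (F_{q^m}^*)^n, and let 1 ≤ k ≤ (n+1)/2. Then (GRS_k(x,y))^{⋆2} = GRS_{2k−1}(x, y⋆y), and consequently dim_{F_{q^m}}(GRS_k(x,y))^{⋆2} = 2k − 1. -/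
open Finset Polynomial

/-- Weighted evaluation `P ↦ (y i * P (x i))_i` of polynomials. -/
noncomputable def weightedEval {F : Type*} [Field F] {n : ℕ} (x y : Fin n → F) :
    F[X] →ₗ[F] (Fin n → F) :=
  LinearMap.pi fun i => y i • Polynomial.leval (x i)

theorem weightedEval_apply {F : Type*} [Field F] {n : ℕ} (x y : Fin n → F) (P : F[X]) :
    weightedEval x y P = fun i => y i * P.eval (x i) := by
  ext i
  simp [weightedEval]

theorem weightedEval_mul {F : Type*} [Field F] {n : ℕ} (x y z : Fin n → F) (P Q : F[X]) :
    weightedEval x (y * z) (P * Q) = weightedEval x y P * weightedEval x z Q := by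
  ext i
  simp only [weightedEval_apply, eval_mul, Pi.mul_apply]
  ring

theorem GRSCode_eq_map {F : Type*} [Field F] {n : ℕ} (r : ℕ) (x y : Fin n → F) :
    GRSCode r x y = (degreeLT F r).map (weightedEval x y) := by
  rw [GRSCode, ← Submodule.span_eq ((degreeLT F r).map (weightedEval x y))]
  congr 1
  ext v
  simp only [Set.mem_ofPred_eq, SetLike.mem_coe, Submodule.mem_map, mem_degreeLT,
    weightedEval_apply, eq_comm]

/-- The Schur product of two nonzero GRS codes with the same support is a GRS code. -/
theorem schurProd_GRSCode {F : Type*} [Field F] {n : ℕ} {r s : ℕ} (hr : 1 ≤ r) (hs : 1 ≤ s)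
    (x y z : Fin n → F) :
    schurProd (GRSCode r x y) (GRSCode s x z) = GRSCode (r + s - 1) x (y * z) := by
  classical
  simp only [GRSCode_eq_map]
  apply le_antisymm
  · rw [schurProd, Submodule.span_le]
    rintro _ ⟨_, ⟨P, hP, rfl⟩, _, ⟨Q, hQ, rfl⟩, rfl⟩
    refine ⟨P * Q, ?_, weightedEval_mul x y z P Q⟩
    rcases eq_or_ne P 0 with rfl | hP0
    · simp
    rcases eq_or_ne Q 0 with rfl | hQ0
    · simp
    simp only [SetLike.mem_coe, mem_degreeLT] at hP hQ ⊢
    rw [← natDegree_lt_iff_degree_lt hP0] at hP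
    rw [← natDegree_lt_iff_degree_lt hQ0] at hQ
    rw [← natDegree_lt_iff_degree_lt (mul_ne_zero hP0 hQ0), natDegree_mul hP0 hQ0]
    omega
  · rw [degreeLT_eq_span_X_pow, Submodule.map_span_le]
    intro f hf
    obtain ⟨j, hj, rfl⟩ := Finset.mem_image.mp hf
    rw [Finset.mem_range] at hj
    have hX : ∀ {a t : ℕ}, a < t → (X ^ a : F[X]) ∈ degreeLT F t := fun h =>
      mem_degreeLT.2 (by rw [degree_X_pow]; exact_mod_cast h)
    have hsplit : (X ^ j : F[X]) = X ^ min j (r - 1) * X ^ (j - min j (r - 1)) := by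
      rw [← pow_add, Nat.add_sub_cancel' (min_le_left _ _)]
    rw [hsplit, weightedEval_mul]
    exact Submodule.subset_span
      ⟨_, Submodule.mem_map_of_mem (hX (by omega)),
        _, Submodule.mem_map_of_mem (hX (by omega)), rfl⟩

theorem finrank_GRSCode {F : Type*} [Field F] {n r : ℕ} (hr : r ≤ n) {x y : Fin n → F}
    (hx : Function.Injective x) (hy : ∀ i, y i ≠ 0) :
    Module.finrank F (GRSCode r x y) = r := by
  have hinj : Function.Injective ((weightedEval x y).domRestrict (degreeLT F r)) := by
    rw [injective_iff_map_eq_zero]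
    rintro ⟨P, hP⟩ h
    have hcard : P.degree < (Finset.univ : Finset (Fin n)).card :=
      (mem_degreeLT.1 hP).trans_le (by simpa using hr)
    refine Subtype.ext (Polynomial.eq_zero_of_degree_lt_of_eval_index_eq_zero
      (v := x) Finset.univ hx.injOn hcard fun i _ => ?_)
    have hi := congrFun h i
    simpa [weightedEval_apply, hy i] using hi
  rw [GRSCode_eq_map, ← LinearMap.range_domRestrict, LinearMap.finrank_range_of_inj hinj,
    (degreeLTEquiv F r).finrank_eq, Module.finrank_fin_fun]

/-- For `x ∈ F_{q^m}^n` with pairwise distinct entries,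
`y ∈ (F_{q^m}^*)^n` and `1 ≤ k ≤ (n+1)/2`:
`(GRS_k(x,y))^{⋆2} = GRS_{2k−1}(x, y⋆y)` and
`dim_{F_{q^m}} (GRS_k(x,y))^{⋆2} = 2k − 1`. -/
theorem sq_GRSCode_eq_and_finrank
    (q m n : ℕ) (hm : 0 < m)
    (Fq Fqm : Type*) [Field Fq] [Field Fqm] [Algebra Fq Fqm]
    [Fintype Fq] [Fintype Fqm]
    (hq : Fintype.card Fq = q) (hqm : Fintype.card Fqm = q ^ m)
    (k : ℕ) (hk : 1 ≤ k) (hk2 : 2 * k ≤ n + 1)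
    (x y : Fin n → Fqm) (hx : Function.Injective x) (hy : ∀ i, y i ≠ 0) :
    schurProd (GRSCode k x y) (GRSCode k x y) = GRSCode (2 * k - 1) x (y * y) ∧
      Module.finrank Fqm ↥(schurProd (GRSCode k x y) (GRSCode k x y)) = 2 * k - 1 := by
  have hsq := schurProd_GRSCode hk hk x y y
  rw [← two_mul] at hsq
  refine ⟨hsq, ?_⟩
  rw [hsq]
  exact finrank_GRSCode (by omega) hx fun i => mul_ne_zero (hy i) (hy i)
end

section
/- Let C = GRS_r(x,y) over F_{q^m} with r ≥ 1. For every non-negative integer u, Tr(C ⋆ C^{q^u}) ⊆ Alt_{(r−1)(1+q^u)+1}(x, y^{1+q^u})^⊥, where y^{1+q^u} denotes the vector with i-th entry y_i^{1+q^u}. -/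
open Finset Polynomial

theorem mem_GRSCode_iff {F : Type*} [Field F] {n r : ℕ} {x y v : Fin n → F} :
    v ∈ GRSCode r x y ↔
      ∃ P : F[X], P.degree < (r : WithBot ℕ) ∧ v = fun i => y i * P.eval (x i) := by
  refine ⟨fun hv => ?_, fun hv => Submodule.subset_span hv⟩
  induction hv using Submodule.span_induction with
  | mem v hv => exact hv
  | zero => exact ⟨0, by simp, by ext i; simp⟩
  | add v w _ _ hv hw =>
    obtain ⟨P, hP, rfl⟩ := hv
    obtain ⟨Q, hQ, rfl⟩ := hw
    exact ⟨P + Q, (degree_add_le P Q).trans_lt (max_lt hP hQ), by ext i; simp [mul_add]⟩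
  | smul a v _ hv =>
    obtain ⟨P, hP, rfl⟩ := hv
    exact ⟨a • P, (degree_smul_le a P).trans_lt hP, by ext i; simp [mul_left_comm]⟩

/-- The Schur product of `GRS_r(x,y)` with its componentwise `t`-th power lies in a single
generalized Reed–Solomon code with multiplier `y^{1+t}`. -/
theorem schurProd_GRSCode_powCode_le {F : Type*} [Field F] {n r : ℕ} (hr : 1 ≤ r) (t : ℕ)
    (x y : Fin n → F) :
    schurProd (GRSCode r x y) (powCode t (GRSCode r x y)) ≤
      GRSCode ((r - 1) * (1 + t) + 1) x fun i => y i ^ (1 + t) := by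
  refine Submodule.span_le.mpr ?_
  rintro _ ⟨c, hc, d, hd, rfl⟩
  obtain ⟨P, hP, rfl⟩ := mem_GRSCode_iff.mp hc
  rw [SetLike.mem_coe]
  induction hd using Submodule.span_induction with
  | mem d hd =>
    obtain ⟨e, he, rfl⟩ := hd
    obtain ⟨Q, hQ, rfl⟩ := mem_GRSCode_iff.mp he
    refine mem_GRSCode_iff.mpr ⟨P * Q ^ t, ?_, ?_⟩
    · have natDegree_le (R : F[X]) (hR : R.degree < (r : WithBot ℕ)) : R.natDegree ≤ r - 1 :=
        natDegree_le_iff_coeff_eq_zero.mpr fun N hN =>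
          coeff_eq_zero_of_degree_lt (hR.trans_le (Nat.cast_le.mpr (by omega)))
      refine degree_le_natDegree.trans_lt (Nat.cast_lt.mpr (Nat.lt_succ_of_le ?_))
      calc (P * Q ^ t).natDegree ≤ P.natDegree + t * Q.natDegree :=
            natDegree_mul_le.trans (by gcongr; exact natDegree_pow_le)
        _ ≤ (r - 1) + t * (r - 1) := by
            gcongr
            exacts [natDegree_le P hP, natDegree_le Q hQ]
        _ = (r - 1) * (1 + t) := by ring
    · ext i
      simp only [Pi.mul_apply, eval_mul, eval_pow]
      ring
  | zero => simp
  | add d e _ _ hd he => rw [mul_add _ d e]; exact add_mem hd he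
  | smul a d _ hd => rw [mul_smul_comm]; exact Submodule.smul_mem _ a hd

/-- The easy inclusion of Delsarte's theorem: `Tr(C) ⊆ (C^⊥ ∩ F_q^n)^⊥`. -/
theorem traceCode_le_dualCode_comap (K L : Type*) [Field K] [Field L] [Algebra K L] {n : ℕ}
    (C : Submodule L (Fin n → L)) :
    traceCode K L C ≤
      dualCode (Submodule.comap (algVecLM K L n) ((dualCode C).restrictScalars K)) := by
  rintro _ ⟨w, hw, rfl⟩ c hc
  have h : ∑ i, c i • w i = 0 := by
    simpa [algVecLM, Algebra.smul_def] using hc w hw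
  simpa [trVecLM, mul_comm] using congrArg (Algebra.trace K L) h

/-- For `C = GRS_r(x,y)` and any non-negative integer `u`,
`Tr(C ⋆ C^{q^u}) ⊆ Alt_{(r−1)(1+q^u)+1}(x, y^{1+q^u})^⊥`. -/
theorem traceCode_schur_frob_le_dual_altCode
    (q m n : ℕ) (hm : 1 < m)
    (Fq Fqm : Type*) [Field Fq] [Field Fqm] [Algebra Fq Fqm]
    [Fintype Fq] [Fintype Fqm]
    (hq : Fintype.card Fq = q) (hqm : Fintype.card Fqm = q ^ m)
    (r : ℕ) (hr : 1 ≤ r) (u : ℕ)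
    (x y : Fin n → Fqm) (hx : Function.Injective x) (hy : ∀ i, y i ≠ 0) :
    traceCode Fq Fqm (schurProd (GRSCode r x y) (powCode (q ^ u) (GRSCode r x y))) ≤
      dualCode (AltCode Fq Fqm ((r - 1) * (1 + q ^ u) + 1) x
        fun i => y i ^ (1 + q ^ u)) := by
  refine le_trans (Submodule.map_mono ?_) (traceCode_le_dualCode_comap Fq Fqm _)
  exact schurProd_GRSCode_powCode_le hr (q ^ u) x y
end

section
/- Let C = GRS_r(x,y) over F_{q^m} with r ≥ 1, and set f = ⌊log_q(r)⌋. For every integer u with 0 ≤ u ≤ f, Tr(C ⋆ C^{q^u}) = Alt_{(r−1)(1+q^u)+1}(x, y^{1+q^u})^⊥, where y^{1+q^u} denotes the vector with i-th entry y_i^{1+q^u}. -/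
open Finset Polynomial

theorem natDegree_lt_of_degree_lt {F : Type*} [Field F] {P : F[X]} {r : ℕ} (hr : 0 < r)
    (hP : P.degree < (r : WithBot ℕ)) : P.natDegree < r := by
  by_cases h : P = 0
  · simpa [h] using hr
  · exact (natDegree_lt_iff_degree_lt h).2 hP

theorem mem_GRSCode {F : Type*} [Field F] {n : ℕ} {r : ℕ} {x y v : Fin n → F} :
    v ∈ GRSCode r x y ↔
      ∃ P : F[X], P.degree < (r : WithBot ℕ) ∧ v = fun i => y i * P.eval (x i) := by
  refine ⟨fun h => ?_, fun h => Submodule.subset_span h⟩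
  induction h using Submodule.span_induction with
  | mem v h => exact h
  | zero => exact ⟨0, by simp, by ext i; simp⟩
  | add a b _ _ ha hb =>
    obtain ⟨P, hP, rfl⟩ := ha
    obtain ⟨Q, hQ, rfl⟩ := hb
    exact ⟨P + Q, (degree_add_le P Q).trans_lt (max_lt hP hQ), by ext i; simp [mul_add]⟩
  | smul t a _ ha =>
    obtain ⟨P, hP, rfl⟩ := ha
    exact ⟨t • P, (degree_smul_le t P).trans_lt hP, by ext i; simp [mul_left_comm]⟩

theorem monomial_mem_GRSCode {F : Type*} [Field F] {n : ℕ} {r k : ℕ} (x y : Fin n → F)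
    (hk : k < r) : (fun i => y i * x i ^ k) ∈ GRSCode r x y :=
  mem_GRSCode.2 ⟨X ^ k, by rw [degree_X_pow]; exact_mod_cast hk, by simp⟩

/-- Every `e ≤ (r - 1) (1 + t)` is of the form `i + t j` with `i, j < r`, provided `t ≤ r`. -/
theorem exists_add_mul_eq_of_le {r t e : ℕ} (hr : 1 ≤ r) (ht : 0 < t) (htr : t ≤ r)
    (he : e ≤ (r - 1) * (1 + t)) : ∃ i < r, ∃ j < r, i + t * j = e := by
  obtain h | h := lt_or_ge (e / t) r
  · exact ⟨e % t, (Nat.mod_lt e ht).trans_le htr, e / t, h, Nat.mod_add_div e t⟩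
  · have h1 : r * t ≤ e := (Nat.le_div_iff_mul_le ht).1 h
    obtain ⟨s, rfl⟩ : ∃ s, r = s + 1 := ⟨r - 1, by omega⟩
    refine ⟨e - t * s, ?_, s, by omega, ?_⟩
    · simp only [Nat.add_sub_cancel] at he
      have : s * (1 + t) = s + t * s := by ring
      omega
    · have : (s + 1) * t = t * s + t := by ring
      omega

theorem schurProd_GRSCode_powCode {F : Type*} [Field F] {n r t : ℕ} (x y : Fin n → F)
    (hr : 1 ≤ r) (ht : 0 < t) (htr : t ≤ r) :
    schurProd (GRSCode r x y) (powCode t (GRSCode r x y)) =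
      GRSCode ((r - 1) * (1 + t) + 1) x fun i => y i ^ (1 + t) := by
  apply le_antisymm
  · refine Submodule.span_le.2 ?_
    rintro _ ⟨c, hc, d, hd, rfl⟩
    rw [SetLike.mem_coe]
    obtain ⟨P, hP, rfl⟩ := mem_GRSCode.1 hc
    induction hd using Submodule.span_induction with
    | mem d hd =>
      obtain ⟨_, hd, rfl⟩ := hd
      obtain ⟨Q, hQ, rfl⟩ := mem_GRSCode.1 hd
      refine mem_GRSCode.2 ⟨P * Q ^ t, ?_, ?_⟩
      · have natDegree_le {R : F[X]} (hR : R.degree < (r : WithBot ℕ)) :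
            R.natDegree ≤ r - 1 := by
          have := natDegree_lt_of_degree_lt hr hR
          omega
        refine degree_le_natDegree.trans_lt ?_
        have h1 : (P * Q ^ t).natDegree ≤ P.natDegree + t * Q.natDegree :=
          natDegree_mul_le.trans (Nat.add_le_add_left natDegree_pow_le _)
        have h2 := Nat.mul_le_mul_left t (natDegree_le hQ)
        have h3 : (r - 1) * (1 + t) = (r - 1) + t * (r - 1) := by ring
        have h4 := natDegree_le hP
        exact_mod_cast (by omega : (P * Q ^ t).natDegree < (r - 1) * (1 + t) + 1)
      · ext i
        simp only [Pi.mul_apply, eval_mul, eval_pow]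
        ring
    | zero => simp
    | add a b _ _ ha hb => rw [mul_add _ a b]; exact add_mem ha hb
    | smul s a _ ha => rw [mul_smul_comm]; exact Submodule.smul_mem _ s ha
  · intro v hv
    obtain ⟨P, hP, rfl⟩ := mem_GRSCode.1 hv
    have expand : (fun i => y i ^ (1 + t) * P.eval (x i)) =
        ∑ e ∈ range ((r - 1) * (1 + t) + 1),
          P.coeff e • fun i => y i ^ (1 + t) * x i ^ e := by
      ext i
      rw [eval_eq_sum_range' (natDegree_lt_of_degree_lt (Nat.succ_pos _) hP)]
      simp [Finset.mul_sum, mul_left_comm]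
    rw [expand]
    refine sum_mem fun e he => Submodule.smul_mem _ _ ?_
    obtain ⟨i, hi, j, hj, rfl⟩ :=
      exists_add_mul_eq_of_le hr ht htr (Nat.lt_succ_iff.1 (mem_range.1 he))
    refine Submodule.subset_span ⟨_, monomial_mem_GRSCode x y hi, _,
      Submodule.subset_span ⟨_, monomial_mem_GRSCode x y hj, rfl⟩, ?_⟩
    ext k
    simp only [Pi.mul_apply]
    ring

/-- Delsarte's theorem: the trace code is the dual of the subfield subcode of the dual. -/
theorem traceCode_eq_dualCode_comap (K L : Type*) [Field K] [Field L] [Algebra K L]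
    [FiniteDimensional K L] [Algebra.IsSeparable K L] {n : ℕ}
    (C : Submodule L (Fin n → L)) :
    traceCode K L C =
      dualCode (Submodule.comap (algVecLM K L n) ((dualCode C).restrictScalars K)) := by
  apply le_antisymm
  · rintro _ ⟨c, hc, rfl⟩ w hw
    have h : ∑ i, algebraMap K L (w i) * c i = 0 := hw c hc
    have h' := congrArg (Algebra.trace K L) h
    simp only [← Algebra.smul_def, map_sum, map_smul, map_zero, smul_eq_mul] at h'
    rw [← h']
    exact Finset.sum_congr rfl fun i _ => mul_comm _ _
  · intro v hv
    by_contra hvT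
    obtain ⟨f, hfv, hf⟩ := Submodule.exists_le_ker_of_notMem hvT
    have f_eq (z : Fin n → K) : f z = ∑ i, z i * f (Pi.single i 1) := by
      conv_lhs => rw [pi_eq_sum_univ' z]
      simp
    refine hfv ((f_eq v).trans (hv (fun i => f (Pi.single i 1)) fun c hc => ?_))
    change ∑ i, algebraMap K L (f (Pi.single i 1)) * c i = 0
    refine (traceForm_nondegenerate K L).1 _ fun a => ?_
    have h : f (trVecLM K L n (a • c)) = 0 := hf ⟨a • c, C.smul_mem a hc, rfl⟩
    rw [f_eq] at h
    rw [Algebra.traceForm_apply, Finset.sum_mul, map_sum, ← h]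
    refine Finset.sum_congr rfl fun i _ => ?_
    rw [mul_assoc, ← Algebra.smul_def, map_smul, smul_eq_mul, mul_comm, mul_comm (c i)]
    rfl

/-- For `C = GRS_r(x,y)`, `f = ⌊log_q r⌋` and `0 ≤ u ≤ f`,
`Tr(C ⋆ C^{q^u}) = Alt_{(r−1)(1+q^u)+1}(x, y^{1+q^u})^⊥`. -/
theorem traceCode_schur_frob_eq_dual_altCode
    (q m n : ℕ) (hm : 1 < m)
    (Fq Fqm : Type*) [Field Fq] [Field Fqm] [Algebra Fq Fqm]
    [Fintype Fq] [Fintype Fqm]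
    (hq : Fintype.card Fq = q) (hqm : Fintype.card Fqm = q ^ m)
    (r : ℕ) (hr : 1 ≤ r) (u : ℕ) (hu : u ≤ Nat.log q r)
    (x y : Fin n → Fqm) (hx : Function.Injective x) (hy : ∀ i, y i ≠ 0) :
    traceCode Fq Fqm (schurProd (GRSCode r x y) (powCode (q ^ u) (GRSCode r x y))) =
      dualCode (AltCode Fq Fqm ((r - 1) * (1 + q ^ u) + 1) x
        fun i => y i ^ (1 + q ^ u)) := by
  have hq0 : 0 < q := hq ▸ Fintype.card_pos
  rw [schurProd_GRSCode_powCode x y hr (pow_pos hq0 u) (Nat.pow_le_of_le_log (by omega) hu)]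
  exact traceCode_eq_dualCode_comap Fq Fqm _
end

section
/- Let Γ ∈ F_{q^m}[X] have degree r, let x ∈ F_{q^m}^n have pairwise distinct entries with Γ(x_i) ≠ 0 for all i, let y_i = 1/Γ(x_i), and let v ≥ 1 be an integer. For any P ∈ F_{q^m}[X], write the Euclidean division P = A·Γ^{q^v−q^{v−1}+1} + B with deg B < deg(Γ^{q^v−q^{v−1}+1}). Then (i) Tr(P(x)/Γ(x)^{q^v+1}) = Tr(A(x)^q·Γ(x)/Γ(x)^{q^v+1}) + c for some c ∈ B_v, where the trace and the rational expressions are evaluated component-wise; and (ii) if deg P < r(q^v+1), then deg(A^q·Γ) < deg P. -/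
open Finset Polynomial

/-- The trace of a word of a code lies in the dual of the corresponding subfield subcode
(the easy half of Delsarte's theorem), stated for a word of a GRS code. -/
theorem trace_mem_dualCode_altCode {Fq Fqm : Type*} [Field Fq] [Field Fqm] [Algebra Fq Fqm]
    {n : ℕ} (r : ℕ) (x y u : Fin n → Fqm) (hu : u ∈ GRSCode r x y) :
    (fun i => Algebra.trace Fq Fqm (u i)) ∈ dualCode (AltCode Fq Fqm r x y) := by
  intro w hw
  have h : ∑ i, algebraMap Fq Fqm (w i) * u i = 0 := hw u hu
  have h2 := congrArg (Algebra.trace Fq Fqm) h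
  rw [map_sum, map_zero] at h2
  rw [← h2]
  refine Finset.sum_congr rfl fun i _ => ?_
  rw [← Algebra.smul_def, map_smul, smul_eq_mul, mul_comm]

/-- Over a finite field, the trace is invariant under the relative Frobenius. -/
theorem trace_pow_card {K L : Type*} [Field K] [Field L] [Algebra K L] [Fintype K] [Finite L]
    (z : L) : Algebra.trace K L (z ^ Fintype.card K) = Algebra.trace K L z :=
  Algebra.trace_eq_of_algEquiv (FiniteField.frobeniusAlgEquivOfAlgebraic K L) z

/-- Dividing by `G ^ (q ^ (w + 1) - q ^ w + 1)` leaves a quotient small enough that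
`A ^ q * G` has smaller degree than the dividend. -/
theorem degree_pow_mul_lt_of_div {F : Type*} [Field F] {q r w : ℕ} (hq : 1 < q)
    {G P A B : F[X]} (hG : G.degree = (r : WithBot ℕ)) (hA : A ≠ 0)
    (hdiv : P = A * G ^ (q ^ (w + 1) - q ^ w + 1) + B)
    (hB : B.degree < (G ^ (q ^ (w + 1) - q ^ w + 1)).degree)
    (hP : P.degree < ((r * (q ^ (w + 1) + 1) : ℕ) : WithBot ℕ)) :
    (A ^ q * G).degree < P.degree := by
  have hdegP : P.degree = (A * G ^ (q ^ (w + 1) - q ^ w + 1)).degree := by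
    rw [hdiv]
    refine degree_add_eq_left_of_degree_lt (hB.trans_le ?_)
    rw [mul_comm]
    exact degree_le_mul_left _ hA
  rw [hdegP] at hP ⊢
  rw [degree_mul, degree_pow, hG, degree_eq_natDegree hA] at hP
  rw [degree_mul, degree_pow, degree_mul, degree_pow, hG, degree_eq_natDegree hA]
  simp only [nsmul_eq_mul] at hP ⊢
  norm_cast at hP ⊢
  obtain ⟨k, rfl⟩ := Nat.exists_eq_add_of_lt hq
  have hsub : (1 + k + 1) ^ (w + 1) - (1 + k + 1) ^ w = (1 + k) * (1 + k + 1) ^ w := by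
    rw [pow_succ]
    exact Nat.sub_eq_of_eq_add (by ring)
  rw [hsub] at hP ⊢
  rw [pow_succ] at hP
  generalize (1 + k + 1) ^ w = t at hP ⊢
  have ha : A.natDegree < r * t := by linarith
  have := Nat.mul_lt_mul_of_pos_left ha (show 0 < 1 + k by omega)
  linarith

/-- With `Γ` of degree `r`, `y_i = 1/Γ(x_i)`, `v ≥ 1`, and the
Euclidean division `P = A·Γ^{q^v−q^{v−1}+1} + B`:
(i) `Tr(P(x)/Γ(x)^{q^v+1}) = Tr(A(x)^q·Γ(x)/Γ(x)^{q^v+1}) + c` for some `c ∈ B_v`;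
(ii) if `deg P < r(q^v+1)` then `deg(A^q·Γ) < deg P` (holding by convention if `A = 0`). -/
theorem goppa_euclidean_reduction
    (q m n : ℕ) (hm : 1 < m)
    (Fq Fqm : Type*) [Field Fq] [Field Fqm] [Algebra Fq Fqm]
    [Fintype Fq] [Fintype Fqm]
    (hq : Fintype.card Fq = q) (hqm : Fintype.card Fqm = q ^ m)
    (r : ℕ) (Γ : Polynomial Fqm) (hΓ : Γ.degree = (r : WithBot ℕ))
    (x : Fin n → Fqm) (hx : Function.Injective x) (hΓx : ∀ i, Γ.eval (x i) ≠ 0)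
    (y : Fin n → Fqm) (hy : ∀ i, y i = (Γ.eval (x i))⁻¹)
    (v : ℕ) (hv : 1 ≤ v)
    (P A B : Polynomial Fqm)
    (hdiv : P = A * Γ ^ (q ^ v - q ^ (v - 1) + 1) + B)
    (hB : B.degree < (Γ ^ (q ^ v - q ^ (v - 1) + 1)).degree) :
    (∃ c ∈ BCode Fq Fqm q r x y v,
        (fun i => Algebra.trace Fq Fqm (P.eval (x i) / Γ.eval (x i) ^ (q ^ v + 1))) =
          (fun i => Algebra.trace Fq Fqm
              ((A.eval (x i)) ^ q * Γ.eval (x i) / Γ.eval (x i) ^ (q ^ v + 1))) + c) ∧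
      (P.degree < ((r * (q ^ v + 1) : ℕ) : WithBot ℕ) →
        (A ^ q * Γ).degree < P.degree ∨ A = 0) := by
  obtain ⟨w, rfl⟩ : ∃ w, v = w + 1 := ⟨v - 1, by omega⟩
  rw [Nat.add_sub_cancel] at hdiv hB
  have hq1 : 1 < q := hq ▸ Fintype.one_lt_card
  refine ⟨⟨fun i => Algebra.trace Fq Fqm (B.eval (x i) / Γ.eval (x i) ^ (q ^ (w + 1) + 1)),
    ?_, ?_⟩, fun hP => or_iff_not_imp_right.2 fun hA =>
      degree_pow_mul_lt_of_div hq1 hΓ hA hdiv hB hP⟩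
  · refine trace_mem_dualCode_altCode (r * (q ^ (w + 1) - q ^ w + 1)) x
      (fun i => y i ^ (q ^ (w + 1) + 1)) _ (Submodule.subset_span ⟨B, ?_, ?_⟩)
    · rw [degree_pow, hΓ, nsmul_eq_mul] at hB
      rw [mul_comm]
      exact_mod_cast hB
    · funext i
      simp only [hy, inv_pow, div_eq_inv_mul]
  · funext i
    have hG := hΓx i
    have hle : q ^ w ≤ q ^ (w + 1) := Nat.pow_le_pow_right (by omega) (by omega)
    have hfrob : (A.eval (x i)) ^ q * Γ.eval (x i) / Γ.eval (x i) ^ (q ^ (w + 1) + 1) =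
        (A.eval (x i) / Γ.eval (x i) ^ q ^ w) ^ q := by
      rw [div_pow, ← pow_mul, ← pow_succ, pow_succ _ (q ^ (w + 1)), mul_div_mul_right _ _ hG]
    have hquot : A.eval (x i) * Γ.eval (x i) ^ (q ^ (w + 1) - q ^ w + 1) /
        Γ.eval (x i) ^ (q ^ (w + 1) + 1) = A.eval (x i) / Γ.eval (x i) ^ q ^ w := by
      rw [div_eq_div_iff (pow_ne_zero _ hG) (pow_ne_zero _ hG), mul_assoc, ← pow_add]
      congr 2
      omega
    rw [Pi.add_apply, hfrob, ← hq, trace_pow_card, hq, ← map_add, ← hquot, ← add_div, hdiv,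
      eval_add, eval_mul, eval_pow]
end

section
/- Let Γ ∈ F_{q^m}[X] have degree r, let x ∈ F_{q^m}^n have pairwise distinct entries with Γ(x_i) ≠ 0 for all i, and let y_i = 1/Γ(x_i). Then the codes B_v form a nested family: B_0 ⊆ B_1 ⊆ B_2 ⊆ … , i.e. B_v ⊆ B_{v+1} for every integer v ≥ 0. -/
open Finset Polynomial

/-- The functional `P ↦ ∑ i, c i * (y i ^ s * P (x i))` on polynomials. -/
def weightedEvalSum {F : Type*} [Field F] {n : ℕ} (c x y : Fin n → F) (s : ℕ) : F[X] →ₗ[F] F where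
  toFun P := ∑ i, c i * (y i ^ s * P.eval (x i))
  map_add' P Q := by simp [mul_add, Finset.sum_add_distrib]
  map_smul' a P := by
    simp only [eval_smul, smul_eq_mul, RingHom.id_apply, Finset.mul_sum]
    exact Finset.sum_congr rfl fun i _ => by ring

theorem weightedEvalSum_apply {F : Type*} [Field F] {n : ℕ} (c x y : Fin n → F) (s : ℕ)
    (P : F[X]) : weightedEvalSum c x y s P = ∑ i, c i * (y i ^ s * P.eval (x i)) :=
  rfl

theorem weightedEvalSum_mul_pow {F : Type*} [Field F] {n : ℕ} (c x y : Fin n → F) {Γ : F[X]}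
    (hy : ∀ i, y i * Γ.eval (x i) = 1) (s k : ℕ) (P : F[X]) :
    weightedEvalSum c x y (s + k) (P * Γ ^ k) = weightedEvalSum c x y s P := by
  simp only [weightedEvalSum_apply]
  refine Finset.sum_congr rfl fun i _ => ?_
  have h : y i ^ k * Γ.eval (x i) ^ k = 1 := by rw [← mul_pow, hy, one_pow]
  rw [eval_mul, eval_pow]
  linear_combination c i * y i ^ s * P.eval (x i) * h

theorem weightedEvalSum_pow_card {K F : Type*} [Field K] [Fintype K] [Field F] [Algebra K F]
    {n : ℕ} (c : Fin n → K) (x y : Fin n → F) (s : ℕ) (P : F[X]) :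
    weightedEvalSum (fun i => algebraMap K F (c i)) x y s P ^ Fintype.card K =
      weightedEvalSum (fun i => algebraMap K F (c i)) x y (Fintype.card K * s)
        (P ^ Fintype.card K) := by
  have h := map_sum (FiniteField.frobeniusAlgHom K F)
    (fun i => algebraMap K F (c i) * (y i ^ s * P.eval (x i))) Finset.univ
  simp only [map_mul, AlgHom.commutes, FiniteField.frobeniusAlgHom_apply] at h
  simp only [weightedEvalSum_apply, h, eval_pow]
  exact Finset.sum_congr rfl fun i _ => by ring

theorem mem_AltCode_iff {K F : Type*} [Field K] [Field F] [Algebra K F] {n : ℕ} (k s : ℕ)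
    (x y : Fin n → F) (c : Fin n → K) :
    c ∈ AltCode K F k x (fun i => y i ^ s) ↔ ∀ P : F[X], P.degree < (k : WithBot ℕ) →
      weightedEvalSum (fun i => algebraMap K F (c i)) x y s P = 0 := by
  change (∀ g ∈ GRSCode k x (fun i => y i ^ s), ∑ i, algebraMap K F (c i) * g i = 0) ↔ _
  constructor
  · intro h P hP
    exact h _ (Submodule.subset_span ⟨P, hP, rfl⟩)
  · intro h g hg
    induction hg using Submodule.span_induction with
    | mem g hg =>
      obtain ⟨P, hP, rfl⟩ := hg
      exact h P hP
    | zero => simp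
    | add u v _ _ hu hv => simp [mul_add, Finset.sum_add_distrib, hu, hv]
    | smul a u _ hu => simp [mul_left_comm _ a, ← Finset.mul_sum, hu]

theorem dualCode_anti {F : Type*} [Field F] {n : ℕ} {C D : Submodule F (Fin n → F)}
    (h : C ≤ D) : dualCode D ≤ dualCode C :=
  fun _ hv c hc => hv c (h hc)

theorem degree_mul_pow_lt {F : Type*} [Field F] {Γ : F[X]} {r : ℕ}
    (hΓ : Γ.degree = (r : WithBot ℕ)) {P : F[X]} {a : ℕ} (hP : P.degree < (a : WithBot ℕ))
    (k : ℕ) : (P * Γ ^ k).degree < ((a + k * r : ℕ) : WithBot ℕ) := by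
  have h : (Γ ^ k).degree = ((k * r : ℕ) : WithBot ℕ) := by
    rw [degree_pow, hΓ]; simp
  rw [degree_mul, h, Nat.cast_add]
  exact WithBot.add_lt_add_right (WithBot.coe_ne_bot) hP

theorem exists_degree_sub_smul_lt {F : Type*} [Field F] {P G : F[X]} {a : ℕ}
    (hG : G.degree = (a : WithBot ℕ)) (hP : P.degree < ((a + 1 : ℕ) : WithBot ℕ)) :
    ∃ t : F, (P - t • G).degree < (a : WithBot ℕ) := by
  have hG0 : G.coeff a ≠ 0 := coeff_ne_zero_of_eq_degree hG
  refine ⟨P.coeff a / G.coeff a, (degree_lt_iff_coeff_zero _ _).2 fun k hk => ?_⟩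
  rcases hk.eq_or_lt with rfl | hk
  · simp [hG0]
  · rw [coeff_sub, coeff_smul, (degree_lt_iff_coeff_zero _ _).1 hP k hk,
      coeff_eq_zero_of_degree_lt (p := G) (n := k) (by rw [hG]; exact Nat.cast_lt.2 hk),
      smul_zero, sub_zero]

section

variable {K F : Type*} [Field K] [Fintype K] [Field F] [Algebra K F] {n : ℕ}
  (c : Fin n → K) (x y : Fin n → F) {Γ : F[X]} {r : ℕ}

/-- Frobenius invariance propagates the vanishing of low-degree moments against `Γ ^ (-q N)` from
degree `r (q - 1) N` up to degree `r q N`. -/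
theorem weightedEvalSum_card_mul_eq_zero (hΓ : Γ.degree = (r : WithBot ℕ))
    (hy : ∀ i, y i * Γ.eval (x i) = 1) {l N : ℕ} (hl : Fintype.card K = l + 1)
    (h : ∀ P : F[X], P.degree < ((l * N * r : ℕ) : WithBot ℕ) →
      weightedEvalSum (fun i => algebraMap K F (c i)) x y ((l + 1) * N) P = 0)
    {d : ℕ} (hd : d ≤ N * r) {P : F[X]} (hP : P.degree < ((l * N * r + d : ℕ) : WithBot ℕ)) :
    weightedEvalSum (fun i => algebraMap K F (c i)) x y ((l + 1) * N) P = 0 := by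
  induction d generalizing P with
  | zero => exact h P hP
  | succ d ih =>
    have hl0 : 0 < l := by have := Fintype.one_lt_card (α := K); omega
    have hX : weightedEvalSum (fun i => algebraMap K F (c i)) x y ((l + 1) * N)
        (X ^ d * Γ ^ (l * N)) = 0 := by
      rw [show (l + 1) * N = N + l * N by ring, weightedEvalSum_mul_pow _ _ _ hy]
      refine pow_eq_zero_iff (Fintype.card_ne_zero (α := K)) |>.1 ?_
      rw [weightedEvalSum_pow_card, hl]
      refine ih (by omega) ?_
      rw [← pow_mul, degree_X_pow, Nat.cast_lt]
      have : l * d < l * (N * r) := Nat.mul_lt_mul_of_pos_left (by omega) hl0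
      linarith
    have hdeg : (X ^ d * Γ ^ (l * N)).degree = ((l * N * r + d : ℕ) : WithBot ℕ) := by
      rw [degree_mul, degree_pow Γ, degree_X_pow, hΓ, add_comm]
      simp
    obtain ⟨t, ht⟩ := exists_degree_sub_smul_lt hdeg hP
    have := ih (by omega) ht
    rwa [map_sub, map_smul, hX, smul_zero, sub_zero] at this

theorem weightedEvalSum_eq_zero_of_card_mul (hΓ : Γ.degree = (r : WithBot ℕ))
    (hy : ∀ i, y i * Γ.eval (x i) = 1) {l N : ℕ} (hl : Fintype.card K = l + 1)
    (h : ∀ P : F[X], P.degree < (((l * N + 1) * r : ℕ) : WithBot ℕ) →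
      weightedEvalSum (fun i => algebraMap K F (c i)) x y ((l + 1) * N + 1) P = 0)
    {P : F[X]} (hP : P.degree < (((N + 1) * r : ℕ) : WithBot ℕ)) :
    weightedEvalSum (fun i => algebraMap K F (c i)) x y (N + 1) P = 0 := by
  have hΓ0 : Γ ≠ 0 := by rintro rfl; simp at hΓ
  have hlow : ∀ P : F[X], P.degree < ((l * N * r : ℕ) : WithBot ℕ) →
      weightedEvalSum (fun i => algebraMap K F (c i)) x y ((l + 1) * N) P = 0 := fun Q hQ => by
    rw [← weightedEvalSum_mul_pow _ _ _ hy _ 1]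
    refine h _ ?_
    rw [show (l * N + 1) * r = l * N * r + 1 * r by ring]
    exact degree_mul_pow_lt hΓ hQ 1
  have hquot : (P / Γ).degree < ((N * r : ℕ) : WithBot ℕ) := by
    by_cases hPΓ : P.degree < Γ.degree
    · rw [(Polynomial.div_eq_zero_iff hΓ0).2 hPΓ, degree_zero]
      exact WithBot.bot_lt_coe _
    · have hadd := degree_add_div hΓ0 (not_lt.1 hPΓ)
      rw [← hadd, hΓ, show (N + 1) * r = r + N * r by ring, Nat.cast_add] at hP
      exact lt_of_add_lt_add_left hP
  rw [← EuclideanDomain.mod_add_div P Γ, map_add, mul_comm Γ]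
  have hrem : weightedEvalSum (fun i => algebraMap K F (c i)) x y (N + 1) (P % Γ) = 0 := by
    rw [← weightedEvalSum_mul_pow _ _ _ hy _ (l * N),
      show N + 1 + l * N = (l + 1) * N + 1 by ring]
    refine h _ ?_
    rw [show (l * N + 1) * r = r + l * N * r by ring]
    exact degree_mul_pow_lt hΓ (hΓ ▸ EuclideanDomain.mod_lt P hΓ0) _
  have hmul := weightedEvalSum_mul_pow (fun i => algebraMap K F (c i)) x y hy N 1 (P / Γ)
  rw [pow_one] at hmul
  rw [hrem, hmul, zero_add, ← weightedEvalSum_mul_pow _ _ _ hy _ (l * N),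
    show N + l * N = (l + 1) * N by ring]
  refine weightedEvalSum_card_mul_eq_zero c x y hΓ hy hl hlow le_rfl ?_
  rw [add_comm (l * N * r)]
  exact degree_mul_pow_lt hΓ hquot _

end

theorem AltCode_le_of_card_mul {K F : Type*} [Field K] [Fintype K] [Field F] [Algebra K F] {n : ℕ}
    (x y : Fin n → F) {Γ : F[X]} {r : ℕ} (hΓ : Γ.degree = (r : WithBot ℕ))
    (hy : ∀ i, y i * Γ.eval (x i) = 1) (v : ℕ) {k : ℕ}
    (hk : k ≤ r * (Fintype.card K ^ v + 1)) :
    AltCode K F (r * (Fintype.card K ^ (v + 1) - Fintype.card K ^ v + 1)) x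
        (fun i => y i ^ (Fintype.card K ^ (v + 1) + 1)) ≤
      AltCode K F k x (fun i => y i ^ (Fintype.card K ^ v + 1)) := by
  obtain ⟨l, hl⟩ := Nat.exists_eq_add_one_of_ne_zero (Fintype.card_ne_zero (α := K))
  have hpow : Fintype.card K ^ (v + 1) = (l + 1) * Fintype.card K ^ v := by
    rw [← hl, pow_succ']
  have hsub : r * (Fintype.card K ^ (v + 1) - Fintype.card K ^ v + 1) =
      (l * Fintype.card K ^ v + 1) * r := by
    rw [hpow, Nat.succ_mul, Nat.add_sub_cancel, mul_comm]
  intro c hc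
  rw [hsub, hpow, mem_AltCode_iff] at hc
  refine (mem_AltCode_iff _ _ _ _ _).2 fun P hP => ?_
  refine weightedEvalSum_eq_zero_of_card_mul c x y hΓ hy hl hc (hP.trans_le ?_)
  rw [mul_comm _ r]
  exact Nat.cast_le.2 hk

/-- With `Γ` of degree `r` and `y_i = 1/Γ(x_i)`, the codes `B_v`
form a nested family: `B_v ⊆ B_{v+1}` for every integer `v ≥ 0`. -/
theorem BCode_le_succ
    (q m n : ℕ) (hm : 1 < m)
    (Fq Fqm : Type*) [Field Fq] [Field Fqm] [Algebra Fq Fqm]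
    [Fintype Fq] [Fintype Fqm]
    (hq : Fintype.card Fq = q) (hqm : Fintype.card Fqm = q ^ m)
    (r : ℕ) (Γ : Polynomial Fqm) (hΓ : Γ.degree = (r : WithBot ℕ))
    (x : Fin n → Fqm) (hx : Function.Injective x) (hΓx : ∀ i, Γ.eval (x i) ≠ 0)
    (y : Fin n → Fqm) (hy : ∀ i, y i = (Γ.eval (x i))⁻¹) :
    ∀ v : ℕ, BCode Fq Fqm q r x y v ≤ BCode Fq Fqm q r x y (v + 1) := by
  subst hq
  have hy' : ∀ i, y i * Γ.eval (x i) = 1 := fun i => by rw [hy, inv_mul_cancel₀ (hΓx i)]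
  intro v
  cases v with
  | zero =>
    have h := AltCode_le_of_card_mul (K := Fq) x y hΓ hy' 0 (k := 2 * r - 1)
      (by rw [pow_zero]; omega)
    exact dualCode_anti h
  | succ v =>
    refine dualCode_anti (AltCode_le_of_card_mul x y hΓ hy' (v + 1) ?_)
    exact Nat.mul_le_mul_left r (by omega)
end
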